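/- Let f ∈ W¹₁(ℝⁿ) with n ≥ 3. Then Σ_{j=1}^n ∫₀^∞ F_{t,j}^{**}(t^{n-1}) dt ≤ c ‖∇f‖₁, where F_{t,j}(ξ̂_j) = sup_{|ξ_j| ≥ t} |f̂(ξ)| and F_{t,j}^{**}(s) = s^{-1} ∫₀^s F_{t,j}^*(u) du with F_{t,j}^* the nonincreasing rearrangement of F_{t,j} on ℝ^{n-1}. -/

import Mathlib

open MeasureTheory ENNReal Set
noncomputable section

/-- Nonincreasing rearrangement of an ℝ≥0∞-valued function. -/
def rearr {α : Type*} [MeasurableSpace α] (μ : Measure α) (f : α → ℝ≥0∞) (t : ℝ) : ℝ≥0∞ :=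
  sInf {y : ℝ≥0∞ | μ {x | y < f x} ≤ ENNReal.ofReal t}

/-- The maximal function f**(t) = t⁻¹ ∫₀ᵗ f*(u) du. -/
def rearr2 {α : Type*} [MeasurableSpace α] (μ : Measure α) (f : α → ℝ≥0∞) (t : ℝ) : ℝ≥0∞ :=
  (∫⁻ u in Set.Ioc (0:ℝ) t, rearr μ f u) / ENNReal.ofReal t

/-- g is the k-th weak partial derivative of f on ℝᵐ. -/
def IsWeakDeriv {m : ℕ} (k : Fin m) (f g : (Fin m → ℝ) → ℝ) : Prop :=
  ∀ φ : (Fin m → ℝ) → ℝ, ContDiff ℝ (⊤ : ℕ∞) φ → HasCompactSupport φ →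
    ∫ x, f x * deriv (fun s => φ (Function.update x k s)) (x k) = - ∫ x, g x * φ x

/-- Fourier transform on ℝᵐ: f̂(ξ) = ∫ f(x) e^{-2πi x·ξ} dx. -/
def ft {m : ℕ} (f : (Fin m → ℝ) → ℝ) (ξ : Fin m → ℝ) : ℂ :=
  ∫ x : Fin m → ℝ, (f x : ℂ) * Complex.exp (-2 * Real.pi * Complex.I * (∑ i, x i * ξ i))

/-- F_{t,j}(ξ̂_j) = sup_{|ξ_j| ≥ t} |f̂(ξ)|. -/
def bigF {n : ℕ} (f : (Fin (n+1) → ℝ) → ℝ) (t : ℝ) (j : Fin (n+1))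
    (ξhat : Fin n → ℝ) : ℝ≥0∞ :=
  ⨆ (s : ℝ) (_ : t ≤ |s|), (‖ft f (j.insertNth s ξhat)‖₊ : ℝ≥0∞)

theorem rearr_mono {α : Type*} [MeasurableSpace α] (μ : Measure α) {f g : α → ℝ≥0∞}
    (h : ∀ x, f x ≤ g x) (u : ℝ) : rearr μ f u ≤ rearr μ g u := by
  refine sInf_le_sInf fun y hy => ?_
  exact (measure_mono fun x hx => lt_of_lt_of_le hx (h x)).trans hy

theorem rearr_const_add_le {α : Type*} [MeasurableSpace α] (μ : Measure α) (M : ℝ≥0∞)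
    (g : α → ℝ≥0∞) (u : ℝ) : rearr μ (fun x => M + g x) u ≤ M + rearr μ g u := by
  unfold rearr
  rw [ENNReal.add_sInf]
  refine le_iInf₂ fun y hy => sInf_le ?_
  refine (measure_mono fun x hx => ?_).trans hy
  exact lt_of_add_lt_add_left (a := M) hx

theorem volume_ofReal_lt (c : ℝ≥0∞) :
    volume {y : ℝ | y ∈ Ioi (0 : ℝ) ∧ ENNReal.ofReal y < c} = c := by
  rcases eq_or_ne c ⊤ with rfl | hc
  · have : {y : ℝ | y ∈ Ioi (0 : ℝ) ∧ ENNReal.ofReal y < ⊤} = Ioi 0 := by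
      ext y; simp
    rw [this, Real.volume_Ioi]
  · have : {y : ℝ | y ∈ Ioi (0 : ℝ) ∧ ENNReal.ofReal y < c} = Ioo 0 c.toReal := by
      ext y
      simp only [mem_ofPred_eq, mem_Ioi, mem_Ioo]
      refine and_congr_right fun hy => ?_
      rw [ENNReal.ofReal_lt_iff_lt_toReal hy.le hc]
    rw [this, Real.volume_Ioo, sub_zero, ENNReal.ofReal_toReal hc]

theorem lintegral_indicator_ofReal_lt (c : ℝ≥0∞) :
    ∫⁻ y in Ioi (0 : ℝ), {y : ℝ | ENNReal.ofReal y < c}.indicator 1 y = c := by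
  have hm : MeasurableSet {y : ℝ | ENNReal.ofReal y < c} :=
    measurableSet_lt ENNReal.measurable_ofReal measurable_const
  rw [lintegral_indicator_one hm, Measure.restrict_apply hm]
  conv_rhs => rw [← volume_ofReal_lt c]
  congr 1
  ext y
  simp [and_comm]

/-- The rearrangement does not increase the integral. -/
theorem lintegral_rearr_le {α : Type*} [MeasurableSpace α] (μ : Measure α) [SFinite μ]
    {g : α → ℝ≥0∞} (hg : Measurable g) :
    ∫⁻ u in Ioi (0 : ℝ), rearr μ g u ≤ ∫⁻ x, g x ∂μ := by
  have hanti : Antitone fun y : ℝ => μ {x | ENNReal.ofReal y < g x} := fun a b hab =>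
    measure_mono fun x hx => lt_of_le_of_lt (ENNReal.ofReal_le_ofReal hab) hx
  have hm1 : MeasurableSet {p : ℝ × ℝ | ENNReal.ofReal p.1 < μ {x | ENNReal.ofReal p.2 < g x}} :=
    measurableSet_lt (ENNReal.measurable_ofReal.comp measurable_fst)
      (hanti.measurable.comp measurable_snd)
  have hm2 : MeasurableSet {p : ℝ × α | ENNReal.ofReal p.1 < g p.2} :=
    measurableSet_lt (ENNReal.measurable_ofReal.comp measurable_fst) (hg.comp measurable_snd)
  calc ∫⁻ u in Ioi (0 : ℝ), rearr μ g u
      = ∫⁻ u in Ioi (0 : ℝ), ∫⁻ y in Ioi (0 : ℝ),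
          {y : ℝ | ENNReal.ofReal y < rearr μ g u}.indicator 1 y := by
        simp_rw [lintegral_indicator_ofReal_lt]
    _ ≤ ∫⁻ u in Ioi (0 : ℝ), ∫⁻ y in Ioi (0 : ℝ),
          {p : ℝ × ℝ | ENNReal.ofReal p.1 < μ {x | ENNReal.ofReal p.2 < g x}}.indicator 1
            (u, y) := by
        refine lintegral_mono fun u => lintegral_mono fun y => ?_
        by_cases h : ENNReal.ofReal y < rearr μ g u
        · have h2 : ENNReal.ofReal u < μ {x | ENNReal.ofReal y < g x} := by
            by_contra! h3
            exact absurd h (not_lt.2 (sInf_le h3))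
          simp only [indicator, mem_ofPred_eq, h, h2, if_true]
          exact le_rfl
        · simp [indicator, h]
    _ = ∫⁻ y in Ioi (0 : ℝ), ∫⁻ u in Ioi (0 : ℝ),
          {u : ℝ | ENNReal.ofReal u < μ {x | ENNReal.ofReal y < g x}}.indicator 1 u := by
        rw [lintegral_lintegral_swap]
        · rfl
        · exact (measurable_one.indicator hm1).aemeasurable
    _ = ∫⁻ y in Ioi (0 : ℝ), ∫⁻ x, {p : ℝ × α | ENNReal.ofReal p.1 < g p.2}.indicator 1
          (y, x) ∂μ := by
        simp_rw [lintegral_indicator_ofReal_lt]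
        refine lintegral_congr fun y => ?_
        have : MeasurableSet {x | ENNReal.ofReal y < g x} := measurableSet_lt measurable_const hg
        rw [← lintegral_indicator_one this]
        rfl
    _ = ∫⁻ x, (∫⁻ y in Ioi (0 : ℝ), {y : ℝ | ENNReal.ofReal y < g x}.indicator 1 y) ∂μ := by
        rw [lintegral_lintegral_swap]
        · rfl
        · exact (measurable_one.indicator hm2).aemeasurable
    _ = ∫⁻ x, g x ∂μ := by simp_rw [lintegral_indicator_ofReal_lt]

theorem rearr2_mono {α : Type*} [MeasurableSpace α] (μ : Measure α) {f g : α → ℝ≥0∞}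
    (h : ∀ x, f x ≤ g x) (s : ℝ) : rearr2 μ f s ≤ rearr2 μ g s :=
  ENNReal.div_le_div_right (lintegral_mono fun u => rearr_mono μ h u) _

theorem rearr2_const_add_le {α : Type*} [MeasurableSpace α] (μ : Measure α) (M : ℝ≥0∞)
    (g : α → ℝ≥0∞) {s : ℝ} (hs : 0 < s) :
    rearr2 μ (fun x => M + g x) s ≤ M + rearr2 μ g s := by
  have hs' : ENNReal.ofReal s ≠ 0 := by simpa using hs
  unfold rearr2
  calc (∫⁻ u in Ioc (0 : ℝ) s, rearr μ (fun x => M + g x) u) / ENNReal.ofReal s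
      ≤ (∫⁻ u in Ioc (0 : ℝ) s, (M + rearr μ g u)) / ENNReal.ofReal s :=
        ENNReal.div_le_div_right (lintegral_mono fun u => rearr_const_add_le μ M g u) _
    _ = (M * ENNReal.ofReal s + ∫⁻ u in Ioc (0 : ℝ) s, rearr μ g u) / ENNReal.ofReal s := by
        rw [lintegral_add_left measurable_const]
        simp
    _ = _ := by
        rw [ENNReal.add_div, ENNReal.mul_div_cancel_right hs' ENNReal.ofReal_ne_top]

/-- The maximal function of a sum of a constant and an integrable function. -/
theorem rearr2_le_const_add_lintegral {α : Type*} [MeasurableSpace α] (μ : Measure α) [SFinite μ]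
    {f g : α → ℝ≥0∞} {M : ℝ≥0∞} (hg : Measurable g) (h : ∀ x, f x ≤ M + g x)
    {s : ℝ} (hs : 0 < s) :
    rearr2 μ f s ≤ M + (∫⁻ x, g x ∂μ) / ENNReal.ofReal s := by
  refine (rearr2_mono μ h s).trans ((rearr2_const_add_le μ M g hs).trans ?_)
  refine add_le_add le_rfl (ENNReal.div_le_div_right ?_ _)
  exact (lintegral_mono_set Ioc_subset_Ioi_self).trans (lintegral_rearr_le μ hg)

/-- The profile `min (1, (T / t) ^ (9 / 8))`, which is integrable in `t`. -/
def decay (T t : ℝ) : ℝ := min 1 ((T / t) ^ (9 / 8 : ℝ))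

/-- A majorant, of small mean, of the part of `g` exceeding `V * decay T t`
at a point of norm `r`. -/
def excess (V T t r : ℝ) (g : ℝ≥0∞) : ℝ≥0∞ :=
  if t ≤ T then 0
  else if r ≤ T * (t / T) ^ (1 / 4 : ℝ) then ENNReal.ofReal V
  else g ^ 2 / ENNReal.ofReal (V * decay T t)

theorem decay_of_le {T t : ℝ} (ht : 0 < t) (h : t ≤ T) : decay T t = 1 := by
  refine min_eq_left (Real.one_le_rpow ?_ (by norm_num))
  rwa [one_le_div ht]

theorem decay_of_lt {T t : ℝ} (hT : 0 ≤ T) (ht : 0 < t) (h : T < t) :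
    decay T t = (T / t) ^ (9 / 8 : ℝ) := by
  refine min_eq_right (Real.rpow_le_one (by positivity) ?_ (by norm_num))
  rw [div_le_one ht]
  exact h.le

theorem le_add_excess {V T t r : ℝ} {g : ℝ≥0∞} (ht : 0 < t) (hg : g ≤ ENNReal.ofReal V) :
    g ≤ ENNReal.ofReal (V * decay T t) + excess V T t r g := by
  unfold excess
  split_ifs with h1 h2
  · rw [decay_of_le ht h1, mul_one, add_zero]
    exact hg
  · exact hg.trans le_add_self
  · rcases le_or_gt g (ENNReal.ofReal (V * decay T t)) with h | h
    · exact h.trans le_self_add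
    · refine le_trans ?_ le_add_self
      rw [ENNReal.le_div_iff_mul_le (Or.inr (pow_ne_zero 2 (ne_bot_of_gt h)))
        (Or.inl ENNReal.ofReal_ne_top), pow_two]
      exact mul_le_mul' le_rfl h.le

theorem excess_zero (T t r : ℝ) : excess 0 T t r 0 = 0 := by
  simp [excess]

theorem lintegral_excess_le {n : ℕ} (hn : 2 ≤ n) {V T t K : ℝ} (hV : 0 < V) (hT : 0 < T)
    (ht : 0 < t) (hK : 0 ≤ K) {G : (Fin n → ℝ) → ℝ≥0∞}
    (htail : ∀ R : ℝ, 0 < R → ∫⁻ ξ in {ξ | R < ‖ξ‖}, G ξ ^ 2 ≤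
      ENNReal.ofReal (K * V ^ 2 * T ^ (n + 1) / R)) :
    (∫⁻ ξ, excess V T t ‖ξ‖ (G ξ)) / ENNReal.ofReal (t ^ n) ≤
      ENNReal.ofReal ((2 ^ n + K) * (V * decay T t)) := by
  rcases le_or_gt t T with h | h
  · simp [excess, h]
  set ρ : ℝ := T / t with hρ
  have hρ0 : 0 < ρ := by positivity
  have hρ1 : ρ ≤ 1 := by rw [hρ, div_le_one ht]; exact h.le
  set R : ℝ := T * (t / T) ^ (1 / 4 : ℝ) with hR
  have hR0 : 0 < R := by positivity
  have hTρ : T = t * ρ := by rw [hρ]; field_simp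
  have hRρ : R = t * ρ ^ (3 / 4 : ℝ) := by
    have : t / T = ρ⁻¹ := by rw [hρ, inv_div]
    rw [hR, this, Real.inv_rpow hρ0.le, ← Real.rpow_neg hρ0.le, hTρ, mul_assoc]
    congr 1
    nth_rewrite 1 [← Real.rpow_one ρ]
    rw [← Real.rpow_add hρ0]
    norm_num
  have hd : decay T t = ρ ^ (9 / 8 : ℝ) := decay_of_lt hT.le ht h
  set M : ℝ := V * decay T t with hM
  have hM0 : 0 < M := by rw [hM, hd]; positivity
  have hsplit : ∫⁻ ξ : Fin n → ℝ, excess V T t ‖ξ‖ (G ξ) ≤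
      ENNReal.ofReal (V * (2 * R) ^ n + K * V ^ 2 * T ^ (n + 1) / R / M) := by
    have hms : MeasurableSet {ξ : Fin n → ℝ | R < ‖ξ‖} :=
      measurableSet_lt measurable_const measurable_norm
    rw [← lintegral_add_compl _ hms, add_comm, ENNReal.ofReal_add (by positivity) (by positivity)]
    refine add_le_add ?_ ?_
    · have hset : {ξ : Fin n → ℝ | R < ‖ξ‖}ᶜ = Metric.closedBall 0 R := by
        ext ξ; simp
      rw [hset]
      calc ∫⁻ ξ in Metric.closedBall (0 : Fin n → ℝ) R, excess V T t ‖ξ‖ (G ξ)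
          = ∫⁻ ξ in Metric.closedBall (0 : Fin n → ℝ) R, ENNReal.ofReal V := by
            refine setLIntegral_congr_fun Metric.isClosed_closedBall.measurableSet fun ξ hξ => ?_
            have : ‖ξ‖ ≤ R := by simpa using hξ
            simp only [excess, not_le.2 h, ← hR, this, if_false, if_true]
        _ = ENNReal.ofReal (V * (2 * R) ^ n) := by
            rw [setLIntegral_const, Real.volume_pi_closedBall _ hR0.le, Fintype.card_fin,
              ← ENNReal.ofReal_mul hV.le]
        _ ≤ _ := le_rfl
    · calc ∫⁻ ξ in {ξ : Fin n → ℝ | R < ‖ξ‖}, excess V T t ‖ξ‖ (G ξ)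
          = ∫⁻ ξ in {ξ : Fin n → ℝ | R < ‖ξ‖}, (ENNReal.ofReal M)⁻¹ * G ξ ^ 2 := by
            refine setLIntegral_congr_fun hms fun ξ hξ => ?_
            have : ¬ ‖ξ‖ ≤ R := not_le.2 hξ
            simp only [excess, not_le.2 h, ← hR, this, if_false, ← hM]
            rw [mul_comm, div_eq_mul_inv]
        _ = (ENNReal.ofReal M)⁻¹ * ∫⁻ ξ in {ξ : Fin n → ℝ | R < ‖ξ‖}, G ξ ^ 2 := by
            rw [lintegral_const_mul' _ _ (by simpa using hM0)]
        _ ≤ (ENNReal.ofReal M)⁻¹ * ENNReal.ofReal (K * V ^ 2 * T ^ (n + 1) / R) := by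
            gcongr
            exact htail R hR0
        _ = _ := by
            rw [ENNReal.ofReal_div_of_pos hM0, mul_comm, ENNReal.div_eq_inv_mul, mul_comm]
  have h98 : ∀ e : ℝ, 9 / 8 ≤ e → ρ ^ e ≤ ρ ^ (9 / 8 : ℝ) := fun e he =>
    Real.rpow_le_rpow_of_exponent_ge hρ0 hρ1 he
  have hn' : (2 : ℝ) ≤ n := by exact_mod_cast hn
  have e1 : V * (2 * R) ^ n / t ^ n ≤ 2 ^ n * M := by
    have : V * (2 * R) ^ n / t ^ n = 2 ^ n * (V * ρ ^ (3 / 4 * n : ℝ)) := by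
      rw [hRρ, Real.rpow_mul hρ0.le, Real.rpow_natCast, mul_pow, mul_pow]
      field_simp
    rw [this, hM, hd]
    gcongr ?_ * (?_ * ?_)
    exact h98 (3 / 4 * n) (by linarith)
  have e2 : K * V ^ 2 * T ^ (n + 1) / R / M / t ^ n ≤ K * M := by
    have : K * V ^ 2 * T ^ (n + 1) / R / M / t ^ n = K * (V * ρ ^ ((n : ℝ) + 1 - 3 / 4 - 9 / 8)) := by
      rw [hRρ, hM, hd, Real.rpow_sub hρ0, Real.rpow_sub hρ0, Real.rpow_add hρ0, Real.rpow_one,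
        Real.rpow_natCast, hTρ, mul_pow]
      field_simp
      ring
    rw [this, hM, hd]
    gcongr ?_ * (?_ * ?_)
    exact h98 ((n : ℝ) + 1 - 3 / 4 - 9 / 8) (by linarith)
  calc (∫⁻ ξ, excess V T t ‖ξ‖ (G ξ)) / ENNReal.ofReal (t ^ n)
      ≤ ENNReal.ofReal (V * (2 * R) ^ n + K * V ^ 2 * T ^ (n + 1) / R / M) /
        ENNReal.ofReal (t ^ n) := ENNReal.div_le_div_right hsplit _
    _ = ENNReal.ofReal ((V * (2 * R) ^ n + K * V ^ 2 * T ^ (n + 1) / R / M) / t ^ n) := by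
        rw [ENNReal.ofReal_div_of_pos (by positivity)]
    _ ≤ _ := by
        refine ENNReal.ofReal_le_ofReal ?_
        rw [add_div, add_mul]
        exact add_le_add e1 e2

theorem lintegral_decay_le {V T : ℝ} (hV : 0 ≤ V) (hT : 0 < T) :
    ∫⁻ t in Ioi (0 : ℝ), ENNReal.ofReal (V * decay T t) ≤ ENNReal.ofReal (9 * (V * T)) := by
  have hsplit : Ioi (0 : ℝ) = Ioc 0 T ∪ Ioi T := (Ioc_union_Ioi_eq_Ioi hT.le).symm
  rw [hsplit]
  refine (lintegral_union_le _ _ _).trans ?_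
  have e : 9 * (V * T) = V * T + 8 * (V * T) := by ring
  rw [e, ENNReal.ofReal_add (by positivity) (by positivity)]
  refine add_le_add ?_ ?_
  · calc ∫⁻ t in Ioc (0 : ℝ) T, ENNReal.ofReal (V * decay T t)
        ≤ ∫⁻ t in Ioc (0 : ℝ) T, ENNReal.ofReal V := by
          refine lintegral_mono fun t => ENNReal.ofReal_le_ofReal ?_
          exact mul_le_of_le_one_right hV (min_le_left _ _)
      _ = ENNReal.ofReal (V * T) := by
          rw [setLIntegral_const, Real.volume_Ioc, sub_zero, ← ENNReal.ofReal_mul hV]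
      _ ≤ _ := le_rfl
  · have hint : IntegrableOn (fun t : ℝ => V * T ^ (9 / 8 : ℝ) * t ^ (-(9 / 8) : ℝ)) (Ioi T) :=
      (integrableOn_Ioi_rpow_of_lt (by norm_num) hT).const_mul _
    calc ∫⁻ t in Ioi T, ENNReal.ofReal (V * decay T t)
        = ∫⁻ t in Ioi T, ENNReal.ofReal (V * T ^ (9 / 8 : ℝ) * t ^ (-(9 / 8) : ℝ)) := by
          refine setLIntegral_congr_fun measurableSet_Ioi fun t ht => ?_
          have ht0 : 0 < t := hT.trans ht
          rw [decay_of_lt hT.le ht0 ht, Real.div_rpow hT.le ht0.le, Real.rpow_neg ht0.le]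
          congr 1
          ring
      _ = ENNReal.ofReal (∫ t in Ioi T, V * T ^ (9 / 8 : ℝ) * t ^ (-(9 / 8) : ℝ)) := by
          rw [ofReal_integral_eq_lintegral_ofReal hint]
          refine (ae_restrict_iff' measurableSet_Ioi).2 (ae_of_all _ fun t ht => ?_)
          have ht0 : 0 < t := hT.trans ht
          simp only [Pi.zero_apply]
          positivity
      _ ≤ ENNReal.ofReal (8 * (V * T)) := by
          refine ENNReal.ofReal_le_ofReal (le_of_eq ?_)
          rw [integral_const_mul, integral_Ioi_rpow_of_lt (by norm_num) hT]
          have : T ^ (9 / 8 : ℝ) * T ^ (-(9 / 8) + 1 : ℝ) = T := by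
            rw [← Real.rpow_add hT]; norm_num
          calc _ = 8 * (V * (T ^ (9 / 8 : ℝ) * T ^ (-(9 / 8) + 1 : ℝ))) := by ring
            _ = _ := by rw [this]

theorem measurable_ft_param {P : Type*} [MeasurableSpace P] {n : ℕ} {f : P → (Fin n → ℝ) → ℝ}
    (hf : Measurable (Function.uncurry f)) :
    Measurable fun q : P × (Fin n → ℝ) => ft (f q.1) q.2 := by
  have h : Measurable fun z : (P × (Fin n → ℝ)) × (Fin n → ℝ) => (f z.1.1 z.2 : ℂ) *
      Complex.exp (-2 * Real.pi * Complex.I * (∑ i, z.2 i * z.1.2 i)) := by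
    have h1 : Measurable fun z : (P × (Fin n → ℝ)) × (Fin n → ℝ) => f z.1.1 z.2 :=
      hf.comp ((measurable_fst.comp measurable_fst).prodMk measurable_snd)
    have h2 : Measurable fun z : (P × (Fin n → ℝ)) × (Fin n → ℝ) =>
        ((∑ i, z.2 i * z.1.2 i : ℝ) : ℂ) := by
      refine Complex.measurable_ofReal.comp (Finset.measurable_sum _ fun i _ => ?_)
      exact ((measurable_pi_apply i).comp measurable_snd).mul
        ((measurable_pi_apply i).comp (measurable_snd.comp measurable_fst))
    refine (Complex.measurable_ofReal.comp h1).mul (Complex.measurable_exp.comp ?_)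
    simpa using h2.const_mul (-2 * Real.pi * Complex.I)
  exact h.stronglyMeasurable.integral_prod_right.measurable

theorem measurable_ft {n : ℕ} {g : (Fin n → ℝ) → ℝ} (hg : Measurable g) :
    Measurable fun ξ : Fin n → ℝ => ft g ξ := by
  have h1 : Measurable (Function.uncurry fun _ : ℝ => g) := hg.comp measurable_snd
  have h2 : Measurable fun q : ℝ × (Fin n → ℝ) => ft g q.2 := measurable_ft_param h1
  exact Measurable.of_uncurry_left (f := fun (_ : ℝ) (ξ : Fin n → ℝ) => ft g ξ) h2 (x := 0)

theorem norm_exp_ft {n : ℕ} (x ξ : Fin n → ℝ) :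
    ‖Complex.exp (-2 * Real.pi * Complex.I * (∑ i, x i * ξ i))‖ = 1 := by
  have : (-2 * Real.pi * Complex.I * ((∑ i, x i * ξ i : ℝ) : ℂ)) =
      ((-2 * Real.pi * ∑ i, x i * ξ i : ℝ) : ℂ) * Complex.I := by
    push_cast; ring
  rw [this, Complex.norm_exp_ofReal_mul_I]

theorem integrable_ft_integrand {n : ℕ} {g : (Fin n → ℝ) → ℝ} (hg : Integrable g)
    (ξ : Fin n → ℝ) :
    Integrable fun x : Fin n → ℝ =>
      (g x : ℂ) * Complex.exp (-2 * Real.pi * Complex.I * (∑ i, x i * ξ i)) := by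
  refine hg.ofReal.mul_bdd (c := 1) ?_ (ae_of_all _ fun x => (norm_exp_ft x ξ).le)
  exact (by fun_prop : Continuous fun x : Fin n → ℝ =>
    Complex.exp (-2 * Real.pi * Complex.I * (∑ i, x i * ξ i))).aestronglyMeasurable

theorem enorm_ft_le {n : ℕ} (g : (Fin n → ℝ) → ℝ) (ξ : Fin n → ℝ) :
    ‖ft g ξ‖ₑ ≤ ∫⁻ x, ‖g x‖ₑ := by
  refine (enorm_integral_le_lintegral_enorm _).trans (lintegral_mono fun x => le_of_eq ?_)
  rw [enorm_mul, ← ofReal_norm (Complex.exp _), norm_exp_ft]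
  simp [← ofReal_norm]

theorem ft_sub {n : ℕ} {f g : (Fin n → ℝ) → ℝ} (hf : Integrable f) (hg : Integrable g)
    (ξ : Fin n → ℝ) : ft (fun x => f x - g x) ξ = ft f ξ - ft g ξ := by
  unfold ft
  rw [← integral_sub (integrable_ft_integrand hf ξ) (integrable_ft_integrand hg ξ)]
  refine integral_congr_ae (ae_of_all _ fun x => ?_)
  push_cast
  ring

theorem ft_translate {n : ℕ} (g : (Fin n → ℝ) → ℝ) (i : Fin n) (h : ℝ) (ξ : Fin n → ℝ) :
    ft (fun x => g (x + h • Pi.single i (1 : ℝ))) ξ =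
      Complex.exp ((2 * Real.pi * ξ i * h : ℝ) * Complex.I) * ft g ξ := by
  unfold ft
  rw [← integral_add_right_eq_self _ (-(h • Pi.single i (1 : ℝ))), ← integral_const_mul]
  refine integral_congr_ae (ae_of_all _ fun x => ?_)
  have hsum : (∑ k, (x + -(h • Pi.single i (1 : ℝ)) : Fin n → ℝ) k * ξ k) =
      (∑ k, x k * ξ k) - h * ξ i := by
    have : ∀ k, (x + -(h • Pi.single i (1 : ℝ)) : Fin n → ℝ) k * ξ k =
        x k * ξ k - (if k = i then h * ξ i else 0) := by
      intro k
      by_cases hk : k = i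
      · subst hk; simp; ring
      · simp [hk]
    rw [Finset.sum_congr rfl fun k _ => this k, Finset.sum_sub_distrib]
    simp
  simp only [neg_add_cancel_right]
  rw [hsum, mul_left_comm, ← Complex.exp_add]
  congr 2
  push_cast
  ring

/-- Plancherel's identity for smooth compactly supported functions. -/
theorem lintegral_ft_sq {n : ℕ} {g : (Fin n → ℝ) → ℝ} (hg : ContDiff ℝ (⊤ : ℕ∞) g)
    (hc : HasCompactSupport g) : ∫⁻ ξ, ‖ft g ξ‖ₑ ^ 2 = ∫⁻ x, ‖g x‖ₑ ^ 2 := by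
  let E := EuclideanSpace ℝ (Fin n)
  let e : E ≃L[ℝ] (Fin n → ℝ) := EuclideanSpace.equiv (Fin n) ℝ
  let G : E → ℂ := fun x => (g (e x) : ℂ)
  have hG : ContDiff ℝ (⊤ : ℕ∞) G := Complex.ofRealCLM.contDiff.comp (hg.comp e.contDiff)
  have hGc : HasCompactSupport G :=
    (hc.comp_homeomorph e.toHomeomorph).comp_left (g := Complex.ofReal) Complex.ofReal_zero
  let S : SchwartzMap E ℂ := hGc.toSchwartzMap hG
  have hmp : MeasurePreserving (@WithLp.toLp 2 (Fin n → ℝ)) := PiLp.volume_preserving_toLp (Fin n)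
  have hemb : MeasurableEmbedding (@WithLp.toLp 2 (Fin n → ℝ)) :=
    (MeasurableEquiv.toLp 2 (Fin n → ℝ)).measurableEmbedding
  have hF : ∀ ξ : Fin n → ℝ, (FourierTransform.fourier S) (WithLp.toLp 2 ξ) = ft g ξ := by
    intro ξ
    rw [SchwartzMap.fourier_coe, Real.fourier_eq', ← hmp.integral_comp hemb]
    unfold ft
    refine integral_congr_ae (ae_of_all _ fun x => ?_)
    have hin : inner ℝ (WithLp.toLp 2 x : E) (WithLp.toLp 2 ξ) = ∑ i, x i * ξ i := by
      simp [PiLp.inner_apply, mul_comm]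
    simp only [hin]
    rw [smul_eq_mul, mul_comm]
    congr 1
    congr 1
    push_cast
    ring
  have key : ∀ Q : SchwartzMap E ℂ,
      ∫⁻ x : Fin n → ℝ, ‖Q (WithLp.toLp 2 x)‖ₑ ^ 2 = ENNReal.ofReal (∫ x, ‖Q x‖ ^ 2) := by
    intro Q
    have hQ : Integrable fun x => ‖Q x‖ ^ 2 :=
      (memLp_two_iff_integrable_sq_norm Q.continuous.aestronglyMeasurable).1 (Q.memLp 2)
    rw [ofReal_integral_eq_lintegral_ofReal hQ (ae_of_all _ fun x => by positivity), ← hmp.lintegral_comp_emb hemb]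
    refine lintegral_congr fun x => ?_
    rw [ENNReal.ofReal_pow (norm_nonneg _), ofReal_norm]
  have h1 := key (FourierTransform.fourier S)
  rw [SchwartzMap.integral_norm_sq_fourier, ← key S] at h1
  simp_rw [hF] at h1
  rw [h1]
  refine lintegral_congr fun x => ?_
  change ‖((g x : ℝ) : ℂ)‖ₑ ^ 2 = _
  simp [← ofReal_norm]

/-- The sum of the absolute values of the partial derivatives. -/
def gradSum {n : ℕ} (g : (Fin n → ℝ) → ℝ) (x : Fin n → ℝ) : ℝ :=
  ∑ i, |fderiv ℝ g x (Pi.single i 1)|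

theorem lintegral_translate_sub_le {n : ℕ} {g : (Fin n → ℝ) → ℝ} (hg : ContDiff ℝ 1 g)
    (v : Fin n → ℝ) {h : ℝ} (hh : 0 ≤ h) :
    ∫⁻ x, ‖g (x + h • v) - g x‖ₑ ≤ ENNReal.ofReal h * ∫⁻ x, ‖fderiv ℝ g x v‖ₑ := by
  have hcont : Continuous fun x => fderiv ℝ g x v :=
    (hg.continuous_fderiv one_ne_zero).clm_apply continuous_const
  have hderiv : ∀ x (s : ℝ), HasDerivAt (fun s : ℝ => g (x + s • v)) (fderiv ℝ g (x + s • v) v) s := by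
    intro x s
    have h1 : HasFDerivAt g (fderiv ℝ g (x + s • v)) (x + s • v) :=
      (hg.differentiable one_ne_zero _).hasFDerivAt
    have h2 : HasDerivAt (fun s : ℝ => x + s • v) v s := by
      simpa using ((hasDerivAt_id s).smul_const v).const_add x
    exact h1.comp_hasDerivAt s h2
  have hpt : ∀ x, ‖g (x + h • v) - g x‖ₑ ≤ ∫⁻ s in Ioc 0 h, ‖fderiv ℝ g (x + s • v) v‖ₑ := by
    intro x
    have hftc : ∫ s in (0 : ℝ)..h, fderiv ℝ g (x + s • v) v = g (x + h • v) - g x := by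
      rw [intervalIntegral.integral_eq_sub_of_hasDerivAt (fun s _ => hderiv x s)]
      · simp
      · exact (hcont.comp (by fun_prop)).intervalIntegrable _ _
    rw [← hftc, intervalIntegral.integral_of_le hh]
    exact enorm_integral_le_lintegral_enorm _
  calc ∫⁻ x, ‖g (x + h • v) - g x‖ₑ
      ≤ ∫⁻ x, ∫⁻ s in Ioc 0 h, ‖fderiv ℝ g (x + s • v) v‖ₑ := lintegral_mono hpt
    _ = ∫⁻ s in Ioc 0 h, ∫⁻ x, ‖fderiv ℝ g (x + s • v) v‖ₑ := by
        refine lintegral_lintegral_swap ?_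
        refine (Continuous.aemeasurable ?_)
        exact (hcont.comp (by fun_prop : Continuous fun p : (Fin n → ℝ) × ℝ =>
          p.1 + p.2 • v)).enorm
    _ = ∫⁻ s in Ioc 0 h, ∫⁻ x, ‖fderiv ℝ g x v‖ₑ := by
        refine lintegral_congr fun s => ?_
        exact lintegral_add_right_eq_self (fun x => ‖fderiv ℝ g x v‖ₑ) (s • v)
    _ = _ := by
        rw [setLIntegral_const, Real.volume_Ioc, sub_zero, mul_comm]

theorem one_le_average_norm_exp_sub_one_sq {R a : ℝ} (hR : 0 < R) (ha : R < |a|) :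
    1 ≤ ENNReal.ofReal R * ∫⁻ h in Ioc 0 (1 / R),
      ‖Complex.exp ((2 * Real.pi * a * h : ℝ) * Complex.I) - 1‖ₑ ^ 2 := by
  have ha0 : a ≠ 0 := by
    rintro rfl
    simp at ha
    linarith
  have hpt : ∀ h : ℝ, ‖Complex.exp ((2 * Real.pi * a * h : ℝ) * Complex.I) - 1‖ₑ ^ 2 =
      ENNReal.ofReal (2 - 2 * Real.cos (2 * Real.pi * a * h)) := by
    intro h
    rw [← ofReal_norm, ← ENNReal.ofReal_pow (norm_nonneg _)]
    congr 1
    rw [← Complex.normSq_eq_norm_sq, Complex.exp_mul_I, ← Complex.ofReal_cos, ← Complex.ofReal_sin,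
      Complex.normSq_apply]
    simp only [Complex.sub_re, Complex.add_re, Complex.ofReal_re, Complex.mul_re, Complex.I_re,
      Complex.ofReal_im, Complex.I_im, Complex.one_re, Complex.sub_im, Complex.add_im,
      Complex.mul_im, Complex.one_im]
    nlinarith [Real.sin_sq_add_cos_sq (2 * Real.pi * a * h)]
  have hcont : Continuous fun h : ℝ => 2 - 2 * Real.cos (2 * Real.pi * a * h) := by fun_prop
  simp_rw [hpt]
  rw [← ofReal_integral_eq_lintegral_ofReal, ← ENNReal.ofReal_mul hR.le]
  · rw [← intervalIntegral.integral_of_le (by positivity)]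
    have hval : ∫ h in (0 : ℝ)..(1 / R), (2 - 2 * Real.cos (2 * Real.pi * a * h)) =
        2 / R - 2 * ((2 * Real.pi * a)⁻¹ * Real.sin (2 * Real.pi * a * (1 / R))) := by
      rw [intervalIntegral.integral_sub (by simp) (Continuous.intervalIntegrable (by fun_prop) _ _),
        intervalIntegral.integral_const_mul, intervalIntegral.integral_comp_mul_left (fun x => Real.cos x)
          (by positivity), integral_cos]
      simp
      ring
    rw [hval, ENNReal.one_le_ofReal]
    have hs : (2 * Real.pi * a)⁻¹ * Real.sin (2 * Real.pi * a * (1 / R)) ≤ (2 * R)⁻¹ := by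
      refine (le_abs_self _).trans ?_
      rw [abs_mul, abs_inv, abs_mul, abs_of_pos Real.two_pi_pos]
      calc (2 * Real.pi * |a|)⁻¹ * |Real.sin (2 * Real.pi * a * (1 / R))|
          ≤ (2 * Real.pi * |a|)⁻¹ * 1 := by
            gcongr
            exact Real.abs_sin_le_one _
        _ ≤ (2 * R)⁻¹ := by
            rw [mul_one]
            gcongr ?_⁻¹
            nlinarith [Real.pi_gt_three, abs_nonneg a]
    have : R * (2 / R - 2 * (2 * R)⁻¹) = 1 := by field_simp; norm_num
    nlinarith
  · exact hcont.integrableOn_Ioc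
  · exact ae_of_all _ fun h => by
      have := Real.cos_le_one (2 * Real.pi * a * h)
      simp only [Pi.zero_apply]
      linarith

theorem lintegral_ft_sq_coord_tail {n : ℕ} {g : (Fin n → ℝ) → ℝ} (hg : ContDiff ℝ (⊤ : ℕ∞) g)
    (hc : HasCompactSupport g) {L : ℝ} (hL : ∀ x, |g x| ≤ L) (i : Fin n) {R : ℝ} (hR : 0 < R) :
    ∫⁻ ξ in {ξ | R < |ξ i|}, ‖ft g ξ‖ₑ ^ 2 ≤
      ENNReal.ofReal (2 * L / R) * ∫⁻ x, ‖fderiv ℝ g x (Pi.single i 1)‖ₑ := by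
  have hL0 : 0 ≤ L := (abs_nonneg _).trans (hL 0)
  have hgm : Measurable (ft g) := measurable_ft hg.continuous.measurable
  have hgi : Integrable g := hg.continuous.integrable_of_hasCompactSupport hc
  set A := ∫⁻ x, ‖fderiv ℝ g x (Pi.single i 1)‖ₑ with hA
  have hms : MeasurableSet {ξ : Fin n → ℝ | R < |ξ i|} :=
    measurableSet_lt measurable_const (measurable_pi_apply i).abs
  have hstep : ∀ h ∈ Ioc 0 (1 / R),
      ∫⁻ ξ : Fin n → ℝ, ‖Complex.exp ((2 * Real.pi * ξ i * h : ℝ) * Complex.I) - 1‖ₑ ^ 2 *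
        ‖ft g ξ‖ₑ ^ 2 ≤ ENNReal.ofReal (2 * L / R) * A := by
    intro h hh
    set v : Fin n → ℝ := h • Pi.single i (1 : ℝ) with hv
    have hd : ContDiff ℝ (⊤ : ℕ∞) fun x => g (x + v) - g x :=
      (hg.comp (contDiff_id.add contDiff_const)).sub hg
    have hct : HasCompactSupport fun x => g (x + v) :=
      hc.comp_homeomorph (Homeomorph.addRight v)
    have hdc : HasCompactSupport fun x => g (x + v) - g x := hct.sub hc
    calc ∫⁻ ξ : Fin n → ℝ, ‖Complex.exp ((2 * Real.pi * ξ i * h : ℝ) * Complex.I) - 1‖ₑ ^ 2 *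
          ‖ft g ξ‖ₑ ^ 2
        = ∫⁻ ξ, ‖ft (fun x => g (x + v) - g x) ξ‖ₑ ^ 2 := by
          refine lintegral_congr fun ξ => ?_
          rw [ft_sub (hgi.comp_add_right v) hgi, hv, ft_translate, ← sub_one_mul, enorm_mul, mul_pow]
      _ = ∫⁻ x, ‖g (x + v) - g x‖ₑ ^ 2 := lintegral_ft_sq hd hdc
      _ ≤ ∫⁻ x, ENNReal.ofReal (2 * L) * ‖g (x + v) - g x‖ₑ := by
          refine lintegral_mono fun x => ?_
          rw [pow_two]
          gcongr
          rw [← ofReal_norm, Real.norm_eq_abs]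
          refine ENNReal.ofReal_le_ofReal ((abs_sub _ _).trans ?_)
          linarith [hL (x + v), hL x]
      _ = ENNReal.ofReal (2 * L) * ∫⁻ x, ‖g (x + v) - g x‖ₑ :=
          lintegral_const_mul' _ _ ENNReal.ofReal_ne_top
      _ ≤ ENNReal.ofReal (2 * L) * (ENNReal.ofReal h * A) := by
          gcongr
          exact lintegral_translate_sub_le (hg.of_le (by exact_mod_cast le_top)) _ hh.1.le
      _ ≤ ENNReal.ofReal (2 * L) * (ENNReal.ofReal (1 / R) * A) := by
          gcongr
          exact hh.2
      _ = _ := by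
          rw [← mul_assoc, ← ENNReal.ofReal_mul (by positivity), mul_one_div]
  calc ∫⁻ ξ in {ξ | R < |ξ i|}, ‖ft g ξ‖ₑ ^ 2
      ≤ ∫⁻ ξ in {ξ | R < |ξ i|}, ENNReal.ofReal R * ∫⁻ h in Ioc 0 (1 / R),
          ‖Complex.exp ((2 * Real.pi * ξ i * h : ℝ) * Complex.I) - 1‖ₑ ^ 2 * ‖ft g ξ‖ₑ ^ 2 := by
        refine setLIntegral_mono' hms fun ξ hξ => ?_
        rw [lintegral_mul_const'' _ (Continuous.aemeasurable (by fun_prop)), ← mul_assoc]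
        exact le_mul_of_one_le_left' (one_le_average_norm_exp_sub_one_sq hR hξ)
    _ ≤ ∫⁻ ξ : Fin n → ℝ, ENNReal.ofReal R * ∫⁻ h in Ioc 0 (1 / R),
          ‖Complex.exp ((2 * Real.pi * ξ i * h : ℝ) * Complex.I) - 1‖ₑ ^ 2 * ‖ft g ξ‖ₑ ^ 2 :=
        setLIntegral_le_lintegral _ _
    _ = ENNReal.ofReal R * ∫⁻ h in Ioc 0 (1 / R), ∫⁻ ξ : Fin n → ℝ,
          ‖Complex.exp ((2 * Real.pi * ξ i * h : ℝ) * Complex.I) - 1‖ₑ ^ 2 * ‖ft g ξ‖ₑ ^ 2 := by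
        rw [lintegral_const_mul' _ _ ENNReal.ofReal_ne_top, lintegral_lintegral_swap]
        refine Measurable.aemeasurable (Measurable.mul ?_ ((hgm.comp measurable_fst).enorm.pow_const 2))
        exact (Continuous.measurable (by fun_prop))
    _ ≤ ENNReal.ofReal R * ∫⁻ h in Ioc 0 (1 / R), ENNReal.ofReal (2 * L / R) * A := by
        refine mul_le_mul' le_rfl ?_
        exact setLIntegral_mono' measurableSet_Ioc hstep
    _ = ENNReal.ofReal (2 * L / R) * A := by
        rw [setLIntegral_const, Real.volume_Ioc, sub_zero, mul_left_comm,
          ← ENNReal.ofReal_mul hR.le, mul_one_div_cancel hR.ne', ENNReal.ofReal_one, mul_one]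

theorem lintegral_ft_sq_tail {n : ℕ} {g : (Fin n → ℝ) → ℝ} (hg : ContDiff ℝ (⊤ : ℕ∞) g)
    (hc : HasCompactSupport g) {L : ℝ} (hL : ∀ x, |g x| ≤ L) {R : ℝ} (hR : 0 < R) :
    ∫⁻ ξ in {ξ | R < ‖ξ‖}, ‖ft g ξ‖ₑ ^ 2 ≤
      ENNReal.ofReal (2 * L / R) * ∫⁻ x, ENNReal.ofReal (gradSum g x) := by
  have hcont : ∀ i, Continuous fun x => fderiv ℝ g x (Pi.single i 1) := fun i =>
    (hg.continuous_fderiv (by simp)).clm_apply continuous_const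
  have hsub : {ξ : Fin n → ℝ | R < ‖ξ‖} ⊆ ⋃ i, {ξ : Fin n → ℝ | R < |ξ i|} := by
    intro ξ hξ
    by_contra hcon
    simp only [mem_iUnion, mem_ofPred_eq, not_exists, not_lt] at hcon
    exact absurd hξ (not_lt.2 ((pi_norm_le_iff_of_nonneg hR.le).2 hcon))
  have hgr : ∀ x, ENNReal.ofReal (gradSum g x) = ∑ i, ‖fderiv ℝ g x (Pi.single i 1)‖ₑ := by
    intro x
    rw [gradSum, ENNReal.ofReal_sum_of_nonneg fun i _ => abs_nonneg _]
    simp_rw [← ofReal_norm, Real.norm_eq_abs]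
  calc ∫⁻ ξ in {ξ | R < ‖ξ‖}, ‖ft g ξ‖ₑ ^ 2
      ≤ ∫⁻ ξ in ⋃ i, {ξ : Fin n → ℝ | R < |ξ i|}, ‖ft g ξ‖ₑ ^ 2 := lintegral_mono_set hsub
    _ ≤ ∑' i, ∫⁻ ξ in {ξ : Fin n → ℝ | R < |ξ i|}, ‖ft g ξ‖ₑ ^ 2 := lintegral_iUnion_le _ _
    _ = ∑ i, ∫⁻ ξ in {ξ : Fin n → ℝ | R < |ξ i|}, ‖ft g ξ‖ₑ ^ 2 := tsum_fintype _
    _ ≤ ∑ i, ENNReal.ofReal (2 * L / R) * ∫⁻ x, ‖fderiv ℝ g x (Pi.single i 1)‖ₑ :=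
        Finset.sum_le_sum fun i _ => lintegral_ft_sq_coord_tail hg hc hL i hR
    _ = _ := by
        simp_rw [hgr]
        rw [← Finset.mul_sum, lintegral_finsetSum _ fun i _ => (hcont i).enorm.measurable]

/-- The dyadic band `1/2 ≤ |s| ≤ 4`. -/
def band : Set ℝ := {s | 1 / 2 ≤ |s| ∧ |s| ≤ 4}

theorem measurableSet_band : MeasurableSet band :=
  (measurableSet_le measurable_const continuous_abs.measurable).inter
    (measurableSet_le continuous_abs.measurable measurable_const)

/-- A smooth bounded function `φ` living on the band `1 ≤ |s| ≤ 4` whose dyadic dilates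
`2 ^ k * φ (s / 2 ^ k)` add up to `s`, together with a smooth function `ψ` equal to `1` on its
support and vanishing near `0`. -/
structure IsDyadicTruncation (φ ψ : ℝ → ℝ) (C : ℝ) : Prop where
  contDiff_fst : ContDiff ℝ (⊤ : ℕ∞) φ
  contDiff_snd : ContDiff ℝ (⊤ : ℕ∞) ψ
  fst_zero : φ 0 = 0
  snd_zero : ψ 0 = 0
  abs_fst_le : ∀ s, |φ s| ≤ 4
  fst_eq_zero : ∀ s, s ∉ band → φ s = 0
  snd_eq_one : ∀ s, φ s ≠ 0 → ψ s = 1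
  nonneg : 0 ≤ C
  abs_deriv_fst_le : ∀ s, |deriv φ s| ≤ band.indicator (fun _ => C) s
  abs_deriv_snd_le : ∀ s, |deriv ψ s| ≤ band.indicator (fun _ => C) s
  hasSum : ∀ s, HasSum (fun k : ℤ => (2 : ℝ) ^ k * φ (s / 2 ^ k)) s

theorem mem_Icc_of_div_mem_band {s : ℝ} (hs : s ≠ 0) {k : ℤ} (h : s / 2 ^ k ∈ band) :
    k ∈ Finset.Icc (Int.log 2 |s| - 2) (Int.log 2 |s| + 1) := by
  have h2 : (1 : ℝ) < 2 := one_lt_two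
  have hk : (0 : ℝ) < 2 ^ k := by positivity
  obtain ⟨ha, hb⟩ := h
  rw [abs_div, abs_of_pos hk] at ha hb
  rw [le_div_iff₀ hk] at ha
  rw [div_le_iff₀ hk] at hb
  have h3 : (2 : ℝ) ^ Int.log 2 |s| ≤ |s| := by
    simpa using Int.zpow_log_le_self (R := ℝ) (b := 2) (by norm_num) (abs_pos.2 hs)
  have h4 : |s| < (2 : ℝ) ^ (Int.log 2 |s| + 1) := by
    simpa using Int.lt_zpow_succ_log_self (R := ℝ) (b := 2) (by norm_num) |s|
  have e1 : (2 : ℝ) ^ (k + 2) = 4 * 2 ^ k := by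
    rw [zpow_add₀ (by norm_num)]; norm_num [mul_comm]
  have e2 : (2 : ℝ) ^ (k - 1) = 1 / 2 * 2 ^ k := by
    rw [zpow_sub₀ (by norm_num)]; norm_num; ring
  have h5 : Int.log 2 |s| ≤ k + 2 := by
    rw [← zpow_le_zpow_iff_right₀ h2, e1]; linarith
  have h6 : k - 1 < Int.log 2 |s| + 1 := by
    rw [← zpow_lt_zpow_iff_right₀ h2, e2]; linarith
  rw [Finset.mem_Icc]
  omega

theorem tsum_band_le (s : ℝ) :
    ∑' k : ℤ, band.indicator (1 : ℝ → ℝ≥0∞) (s / 2 ^ k) ≤ 4 := by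
  rcases eq_or_ne s 0 with rfl | hs
  · simp [band]
  rw [tsum_eq_sum (s := Finset.Icc (Int.log 2 |s| - 2) (Int.log 2 |s| + 1))]
  · have hle : ∀ k ∈ Finset.Icc (Int.log 2 |s| - 2) (Int.log 2 |s| + 1),
        band.indicator (1 : ℝ → ℝ≥0∞) (s / 2 ^ k) ≤ 1 := fun k _ =>
      indicator_le_self' (f := (1 : ℝ → ℝ≥0∞)) (fun _ _ => zero_le) _
    refine (Finset.sum_le_card_nsmul _ _ 1 hle).trans ?_
    have : (Int.log 2 |s| + 1 + 1 - (Int.log 2 |s| - 2)).toNat = 4 := by omega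
    simp [this]
  · intro k hk
    refine indicator_of_notMem (fun h => hk (mem_Icc_of_div_mem_band hs h)) _

theorem exists_isDyadicTruncation : ∃ φ ψ C, IsDyadicTruncation φ ψ C := by
  let b : ContDiffBump (0 : ℝ) := ⟨1, 2, one_pos, one_lt_two⟩
  let θ : ℝ → ℝ := fun s => 1 - b s
  have hθ : ContDiff ℝ (⊤ : ℕ∞) θ := contDiff_const.sub b.contDiff
  have hθ0 : ∀ s, |s| ≤ 1 → θ s = 0 := by
    intro s hs
    have : b s = 1 := b.one_of_mem_closedBall (by simpa [b] using hs)
    simp [θ, this]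
  have hθ1 : ∀ s, 2 ≤ |s| → θ s = 1 := by
    intro s hs
    have : b s = 0 := b.zero_of_le_dist (by simpa [b] using hs)
    simp [θ, this]
  have hθnn : ∀ s, 0 ≤ θ s := fun s => sub_nonneg.2 b.le_one
  have hθle : ∀ s, θ s ≤ 1 := fun s => sub_le_self _ b.nonneg
  let φ : ℝ → ℝ := fun s => s * (θ s - θ (s / 2))
  let ψ : ℝ → ℝ := fun s => θ (2 * s)
  have hφ : ContDiff ℝ (⊤ : ℕ∞) φ :=
    contDiff_id.mul (hθ.sub (hθ.comp (contDiff_id.div_const 2)))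
  have hψ : ContDiff ℝ (⊤ : ℕ∞) ψ := hθ.comp (contDiff_const.mul contDiff_id)
  have habs2 : ∀ s : ℝ, |s / 2| = |s| / 2 := fun s => by rw [abs_div, abs_two]
  have hφ0 : ∀ s, |s| ≤ 1 → φ s = 0 := by
    intro s hs
    simp only [φ]
    rw [hθ0 s hs, hθ0 _ (by rw [habs2]; linarith [abs_nonneg s])]
    simp
  have hφ4 : ∀ s, 4 ≤ |s| → φ s = 0 := by
    intro s hs
    simp only [φ]
    rw [hθ1 s (by linarith), hθ1 _ (by rw [habs2]; linarith)]
    simp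
  have hψ0 : ∀ s, |s| ≤ 1 / 2 → ψ s = 0 := fun s hs =>
    hθ0 _ (by rw [abs_mul, abs_two]; linarith)
  have hψ1 : ∀ s, 1 ≤ |s| → ψ s = 1 := fun s hs =>
    hθ1 _ (by rw [abs_mul, abs_two]; linarith)
  have hderiv0 : ∀ (h : ℝ → ℝ) (c d : ℝ), (∀ s, |s| ≤ 1 / 2 → h s = c) →
      (∀ s, 4 ≤ |s| → h s = d) → ∀ s, s ∉ band → deriv h s = 0 := by
    intro h c d h1 h2 s hs
    have hs' : |s| < 1 / 2 ∨ 4 < |s| := by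
      by_contra! hcon
      exact hs hcon
    rcases hs' with h3 | h3
    · have : h =ᶠ[nhds s] fun _ => c := by
        filter_upwards [(isOpen_lt continuous_abs continuous_const).mem_nhds h3] with x hx
        exact h1 x (le_of_lt hx)
      rw [this.deriv_eq, deriv_const]
    · have : h =ᶠ[nhds s] fun _ => d := by
        filter_upwards [(isOpen_lt continuous_const continuous_abs).mem_nhds h3] with x hx
        exact h2 x (le_of_lt hx)
      rw [this.deriv_eq, deriv_const]
  have hbdd : ∀ h : ℝ → ℝ, ContDiff ℝ (⊤ : ℕ∞) h → ∃ C, ∀ s ∈ band, |deriv h s| ≤ C := by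
    intro h hh
    obtain ⟨C, hC⟩ := (isCompact_Icc (a := (-4 : ℝ)) (b := 4)).exists_bound_of_continuousOn
      (hh.continuous_deriv (by simp)).continuousOn
    exact ⟨C, fun s hs => hC s (abs_le.1 hs.2)⟩
  obtain ⟨C1, hC1⟩ := hbdd φ hφ
  obtain ⟨C2, hC2⟩ := hbdd ψ hψ
  have hle : ∀ (h : ℝ → ℝ) (c d : ℝ), (∀ s, |s| ≤ 1 / 2 → h s = c) →
      (∀ s, 4 ≤ |s| → h s = d) → (∀ s ∈ band, |deriv h s| ≤ max 0 (max C1 C2)) →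
      ∀ s, |deriv h s| ≤ band.indicator (fun _ => max 0 (max C1 C2)) s := by
    intro h c d h1 h2 h3 s
    by_cases hs : s ∈ band
    · rw [indicator_of_mem hs]; exact h3 s hs
    · rw [indicator_of_notMem hs, hderiv0 h c d h1 h2 s hs, abs_zero]
  refine ⟨φ, ψ, max 0 (max C1 C2), hφ, hψ, hφ0 0 (by simp), hψ0 0 (by simp), ?_, ?_, ?_,
    le_max_left _ _, ?_, ?_, ?_⟩
  · intro s
    rcases le_or_gt 4 |s| with h | h
    · rw [hφ4 s h]; norm_num
    · have : |θ s - θ (s / 2)| ≤ 1 :=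
        abs_le.2 ⟨by linarith [hθnn s, hθle (s / 2)], by linarith [hθle s, hθnn (s / 2)]⟩
      simp only [φ]
      rw [abs_mul]
      nlinarith [abs_nonneg s]
  · intro s hs
    rcases le_or_gt |s| 1 with h | h
    · exact hφ0 s h
    · refine hφ4 s ?_
      by_contra! hcon
      exact hs ⟨by linarith, hcon.le⟩
  · intro s hs
    refine hψ1 s ?_
    by_contra! hcon
    exact hs (hφ0 s hcon.le)
  · exact hle φ 0 0 (fun s hs => hφ0 s (by linarith)) hφ4
      fun s hs => (hC1 s hs).trans ((le_max_left _ _).trans (le_max_right _ _))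
  · exact hle ψ 0 1 hψ0 (fun s hs => hψ1 s (by linarith))
      fun s hs => (hC2 s hs).trans ((le_max_right _ _).trans (le_max_right _ _))
  · intro s
    rcases eq_or_ne s 0 with rfl | hs
    · simp [hφ0 0 (by simp), hasSum_zero]
    set m := Int.log 2 |s| with hm
    have h3 : (2 : ℝ) ^ m ≤ |s| := by
      simpa using Int.zpow_log_le_self (R := ℝ) (b := 2) (by norm_num) (abs_pos.2 hs)
    have h4 : |s| < (2 : ℝ) ^ (m + 1) := by
      simpa using Int.lt_zpow_succ_log_self (R := ℝ) (b := 2) (by norm_num) |s|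
    have hterm : ∀ k : ℤ, (2 : ℝ) ^ k * φ (s / 2 ^ k) =
        s * (θ (s / 2 ^ k) - θ (s / 2 ^ (k + 1))) := by
      intro k
      have hk : (2 : ℝ) ^ k ≠ 0 := by positivity
      simp only [φ]
      rw [zpow_add₀ (by norm_num), zpow_one, div_div]
      field_simp
    have hhigh : ∀ k : ℤ, m + 1 ≤ k → θ (s / 2 ^ k) = 0 := by
      intro k hk
      refine hθ0 _ ?_
      have hp : (0 : ℝ) < 2 ^ k := by positivity
      rw [abs_div, abs_of_pos hp, div_le_one hp]
      exact h4.le.trans (zpow_le_zpow_right₀ one_le_two hk)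
    have hlow : ∀ k : ℤ, k ≤ m - 1 → θ (s / 2 ^ k) = 1 := by
      intro k hk
      refine hθ1 _ ?_
      have hp : (0 : ℝ) < 2 ^ k := by positivity
      rw [abs_div, abs_of_pos hp, le_div_iff₀ hp]
      have : (2 : ℝ) ^ (k + 1) ≤ 2 ^ m := zpow_le_zpow_right₀ one_le_two (by omega)
      rw [zpow_add₀ (by norm_num), zpow_one] at this
      linarith
    have hsum := hasSum_sum_of_ne_finset_zero (L := .unconditional ℤ) (s := ({m - 1, m} : Finset ℤ))
      (f := fun k : ℤ => (2 : ℝ) ^ k * φ (s / 2 ^ k)) (by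
        intro k hk
        simp only [Finset.mem_insert, Finset.mem_singleton, not_or] at hk
        rw [hterm k]
        rcases lt_or_ge k (m - 1) with h | h
        · rw [hlow k h.le, hlow (k + 1) (by omega)]; simp
        · rw [hhigh k (by omega), hhigh (k + 1) (by omega)]; simp)
    convert hsum using 1
    rw [Finset.sum_pair (by omega), hterm, hterm, hlow (m - 1) le_rfl, hhigh (m + 1) le_rfl,
      sub_add_cancel]
    ring

theorem gradSum_nonneg {n : ℕ} (g : (Fin n → ℝ) → ℝ) (x : Fin n → ℝ) : 0 ≤ gradSum g x :=
  Finset.sum_nonneg fun _ _ => abs_nonneg _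

theorem continuous_gradSum {n : ℕ} {g : (Fin n → ℝ) → ℝ} (hg : ContDiff ℝ 1 g) :
    Continuous (gradSum g) :=
  continuous_finsetSum _ fun _ _ =>
    ((hg.continuous_fderiv one_ne_zero).clm_apply continuous_const).abs

theorem norm_fderiv_le_gradSum {n : ℕ} (g : (Fin n → ℝ) → ℝ) (x : Fin n → ℝ) :
    ‖fderiv ℝ g x‖ ≤ gradSum g x := by
  refine ContinuousLinearMap.opNorm_le_bound _ (gradSum_nonneg g x) fun v => ?_
  have hv : v = ∑ i, v i • (Pi.single i (1 : ℝ) : Fin n → ℝ) := (pi_eq_sum_univ' v).trans (by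
    refine Finset.sum_congr rfl fun i _ => ?_
    ext k
    simp [Pi.single_apply, eq_comm])
  calc ‖fderiv ℝ g x v‖ = ‖∑ i, v i * fderiv ℝ g x (Pi.single i 1)‖ := by
        conv_lhs => rw [hv]
        simp [map_sum]
    _ ≤ ∑ i, ‖v i * fderiv ℝ g x (Pi.single i 1)‖ := norm_sum_le _ _
    _ ≤ ∑ i, |fderiv ℝ g x (Pi.single i 1)| * ‖v‖ := by
        refine Finset.sum_le_sum fun i _ => ?_
        rw [norm_mul, mul_comm]
        exact mul_le_mul_of_nonneg_left (norm_le_pi_norm v i) (norm_nonneg _)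
    _ = gradSum g x * ‖v‖ := by rw [gradSum, Finset.sum_mul]

theorem hasCompactSupport_gradSum {n : ℕ} {g : (Fin n → ℝ) → ℝ} (hg : HasCompactSupport g) :
    HasCompactSupport (gradSum g) :=
  (hg.fderiv ℝ).mono fun x hx => by
    intro h0
    exact hx (by simp [gradSum, h0])

theorem gradSum_comp {n : ℕ} {g : (Fin n → ℝ) → ℝ} {h : ℝ → ℝ} (hg : Differentiable ℝ g)
    (hh : Differentiable ℝ h) (c lam : ℝ) (x : Fin n → ℝ) :
    gradSum (fun y => c * h (g y / lam)) x = |c / lam * deriv h (g x / lam)| * gradSum g x := by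
  have h1 : HasFDerivAt (fun y => c * h (g y / lam))
      ((c / lam * deriv h (g x / lam)) • fderiv ℝ g x) x := by
    have hd : HasDerivAt (fun s => c * h (s / lam)) (c / lam * deriv h (g x / lam)) (g x) := by
      have := ((hh (g x / lam)).hasDerivAt.comp (g x) ((hasDerivAt_id (g x)).div_const lam)).const_mul c
      rwa [show c * (deriv h (g x / lam) * (1 / lam)) = c / lam * deriv h (g x / lam) by ring] at this
    exact hd.comp_hasFDerivAt x (hg x).hasFDerivAt
  simp [gradSum, h1.fderiv, abs_mul, Finset.mul_sum]

/-- The part of `u` at height `lam` cut out by `φ`. -/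
def layer {n : ℕ} (φ : ℝ → ℝ) (lam : ℝ) (u : (Fin n → ℝ) → ℝ) (y : Fin n → ℝ) : ℝ :=
  lam * φ (u y / lam)

/-- The mass of a layer. -/
def layerMass {n : ℕ} (φ : ℝ → ℝ) (lam : ℝ) (u : (Fin n → ℝ) → ℝ) : ℝ :=
  (∫⁻ y, ‖layer φ lam u y‖ₑ).toReal

/-- The integral of the gradient of `u` over the region where `u` has size about `lam`. -/
def bandGrad {n : ℕ} (lam : ℝ) (u : (Fin n → ℝ) → ℝ) : ℝ≥0∞ :=
  ∫⁻ y, band.indicator 1 (u y / lam) * ENNReal.ofReal (gradSum u y)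

section Layer

variable {n : ℕ} {φ ψ : ℝ → ℝ} {C lam : ℝ} {u : (Fin n → ℝ) → ℝ}

theorem contDiff_layer {φ : ℝ → ℝ} (hφ : ContDiff ℝ (⊤ : ℕ∞) φ) (hu : ContDiff ℝ (⊤ : ℕ∞) u) :
    ContDiff ℝ (⊤ : ℕ∞) (layer φ lam u) :=
  contDiff_const.mul (hφ.comp (hu.div_const lam))

theorem hasCompactSupport_layer {φ : ℝ → ℝ} (hφ : φ 0 = 0) (hc : HasCompactSupport u) :
    HasCompactSupport (layer φ lam u) :=
  hc.comp_left (g := fun s => lam * φ (s / lam)) (by simp [hφ])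

theorem lintegral_enorm_ne_top {g : (Fin n → ℝ) → ℝ} (hg : Continuous g)
    (hc : HasCompactSupport g) : ∫⁻ x, ‖g x‖ₑ ≠ ⊤ :=
  (hg.integrable_of_hasCompactSupport hc).2.ne

theorem bandGrad_ne_top (hu : ContDiff ℝ 1 u) (hc : HasCompactSupport u) :
    bandGrad lam u ≠ ⊤ := by
  refine ne_top_of_le_ne_top (lintegral_enorm_ne_top (continuous_gradSum hu)
    (hasCompactSupport_gradSum hc)) (lintegral_mono fun y => ?_)
  refine (mul_le_mul_left (indicator_le_self' (f := (1 : ℝ → ℝ≥0∞)) (fun _ _ => zero_le) _) _).trans ?_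
  rw [Pi.one_apply, one_mul, ← ofReal_norm, Real.norm_of_nonneg (gradSum_nonneg u y)]

theorem lintegral_gradSum_comp_le {h : ℝ → ℝ} (hu : ContDiff ℝ 1 u) (hh : Differentiable ℝ h)
    (hd : ∀ s, |deriv h s| ≤ band.indicator (fun _ => C) s) {c : ℝ} (hc : 0 ≤ c)
    (hlam : 0 < lam) :
    ∫⁻ y, ENNReal.ofReal (gradSum (fun y => c * h (u y / lam)) y) ≤
      ENNReal.ofReal (c / lam * C) * bandGrad lam u := by
  rw [bandGrad, ← lintegral_const_mul' _ _ ofReal_ne_top]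
  refine lintegral_mono fun y => ?_
  dsimp only
  rw [gradSum_comp (hu.differentiable one_ne_zero) hh, ENNReal.ofReal_mul (abs_nonneg _),
    ← mul_assoc]
  refine mul_le_mul_left ?_ _
  have hcl : 0 ≤ c / lam := by positivity
  rw [abs_mul, abs_of_nonneg hcl]
  have := hd (u y / lam)
  by_cases hb : u y / lam ∈ band
  · rw [indicator_of_mem hb] at this ⊢
    rw [Pi.one_apply, mul_one]
    exact ENNReal.ofReal_le_ofReal (mul_le_mul_of_nonneg_left this hcl)
  · rw [indicator_of_notMem hb] at this
    rw [le_antisymm this (abs_nonneg _)]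
    simp

theorem ofReal_layerMass {φ : ℝ → ℝ} (hφ : ContDiff ℝ (⊤ : ℕ∞) φ) (hφ0 : φ 0 = 0)
    (hu : ContDiff ℝ (⊤ : ℕ∞) u) (hc : HasCompactSupport u) :
    ENNReal.ofReal (layerMass φ lam u) = ∫⁻ y, ‖layer φ lam u y‖ₑ :=
  ENNReal.ofReal_toReal (lintegral_enorm_ne_top (contDiff_layer hφ hu).continuous
    (hasCompactSupport_layer hφ0 hc))

theorem layerMass_nonneg : 0 ≤ layerMass φ lam u := ENNReal.toReal_nonneg

theorem mul_layerMass_pow_le (hn : 2 ≤ n) (H : IsDyadicTruncation φ ψ C) (hlam : 0 < lam)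
    (hu : ContDiff ℝ (⊤ : ℕ∞) u) (hc : HasCompactSupport u) :
    lam * layerMass φ lam u ^ (n - 1) ≤ 4 ^ (n - 1) * C ^ n * (bandGrad lam u).toReal ^ n := by
  have hn1 : (1 : ℝ) < n := by exact_mod_cast hn
  set p : ℝ := n / (n - 1) with hp
  have hp0 : 0 < p := div_pos (by linarith) (by linarith)
  have hconj : Real.HolderConjugate (Fintype.card (Fin n)) p := by
    rw [Fintype.card_fin]
    exact Real.HolderConjugate.conjExponent hn1
  set w : (Fin n → ℝ) → ℝ := fun y => 1 * ψ (u y / lam) with hw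
  have hu1 : ContDiff ℝ 1 u := hu.of_le (by exact_mod_cast le_top)
  have hwd : ContDiff ℝ 1 w :=
    contDiff_const.mul ((H.contDiff_snd.of_le (by exact_mod_cast le_top)).comp (hu1.div_const lam))
  have hwc : HasCompactSupport w :=
    hc.comp_left (g := fun s => 1 * ψ (s / lam)) (by simp [H.snd_zero])
  have hA := bandGrad_ne_top (lam := lam) hu1 hc
  set A := (bandGrad lam u).toReal with hAdef
  have hA0 : 0 ≤ A := ENNReal.toReal_nonneg
  have hC0 := H.nonneg
  have hsob : ∫⁻ y, ‖w y‖ₑ ^ p ≤ ENNReal.ofReal ((1 / lam * C * A) ^ p) := by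
    refine (lintegral_pow_le_pow_lintegral_fderiv_aux hconj hwd hwc).trans ?_
    rw [← ENNReal.ofReal_rpow_of_nonneg (by positivity) hp0.le]
    refine ENNReal.rpow_le_rpow ?_ hp0.le
    calc ∫⁻ y, ‖fderiv ℝ w y‖ₑ ≤ ∫⁻ y, ENNReal.ofReal (gradSum w y) := by
          refine lintegral_mono fun y => ?_
          rw [← ofReal_norm]
          exact ENNReal.ofReal_le_ofReal (norm_fderiv_le_gradSum w y)
      _ ≤ ENNReal.ofReal (1 / lam * C) * bandGrad lam u :=
          lintegral_gradSum_comp_le hu1 (H.contDiff_snd.differentiable (by simp))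
            H.abs_deriv_snd_le zero_le_one hlam
      _ = ENNReal.ofReal (1 / lam * C * A) := by
          rw [ENNReal.ofReal_mul (q := A) (by positivity), ENNReal.ofReal_toReal hA]
  have hV : layerMass φ lam u ≤ 4 * lam * (1 / lam * C * A) ^ p := by
    rw [← ENNReal.ofReal_le_ofReal_iff (by positivity),
      ofReal_layerMass H.contDiff_fst H.fst_zero hu hc, ENNReal.ofReal_mul (by positivity)]
    refine le_trans ?_ (mul_le_mul_right hsob _)
    rw [← lintegral_const_mul' _ _ ofReal_ne_top]
    refine lintegral_mono fun y => ?_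
    by_cases h0 : φ (u y / lam) = 0
    · simp [layer, h0]
    · have : w y = 1 := by simp [hw, H.snd_eq_one _ h0]
      rw [this, ← ofReal_norm]
      simp only [enorm_one, ENNReal.one_rpow, mul_one]
      refine ENNReal.ofReal_le_ofReal ?_
      rw [layer, Real.norm_eq_abs, abs_mul, abs_of_pos hlam, mul_comm]
      exact mul_le_mul_of_nonneg_right (H.abs_fst_le _) hlam.le
  have hpow := pow_le_pow_left₀ layerMass_nonneg hV (n - 1)
  have hexp : ((1 / lam * C * A) ^ p) ^ (n - 1) = (1 / lam * C * A) ^ n := by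
    rw [← Real.rpow_natCast, ← Real.rpow_mul (by positivity), ← Real.rpow_natCast]
    congr 1
    rw [Nat.cast_sub (by omega), Nat.cast_one, hp]
    have : (n : ℝ) - 1 ≠ 0 := by linarith
    field_simp
  calc lam * layerMass φ lam u ^ (n - 1)
      ≤ lam * (4 * lam * (1 / lam * C * A) ^ p) ^ (n - 1) :=
        mul_le_mul_of_nonneg_left hpow hlam.le
    _ = 4 ^ (n - 1) * C ^ n * A ^ n := by
        rw [mul_pow, hexp, mul_pow, mul_pow, mul_pow]
        obtain ⟨m, rfl⟩ : ∃ m, n = m + 1 := ⟨n - 1, by omega⟩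
        simp only [Nat.add_sub_cancel, one_div, inv_pow]
        field_simp
        ring

theorem bandGrad_toReal_pos (hn : 2 ≤ n) (H : IsDyadicTruncation φ ψ C) (hlam : 0 < lam)
    (hu : ContDiff ℝ (⊤ : ℕ∞) u) (hc : HasCompactSupport u) (hV : 0 < layerMass φ lam u) :
    0 < (bandGrad lam u).toReal := by
  refine lt_of_le_of_ne ENNReal.toReal_nonneg fun h0 => ?_
  have h := mul_layerMass_pow_le hn H hlam hu hc
  rw [← h0, zero_pow (by omega), mul_zero] at h
  exact absurd h (not_le.2 (by positivity))

theorem lintegral_ft_layer_sq_tail (hn : 2 ≤ n) (H : IsDyadicTruncation φ ψ C) (hlam : 0 < lam)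
    (hu : ContDiff ℝ (⊤ : ℕ∞) u) (hc : HasCompactSupport u) (hV : 0 < layerMass φ lam u)
    {R : ℝ} (hR : 0 < R) :
    ∫⁻ ξ in {ξ | R < ‖ξ‖}, ‖ft (layer φ lam u) ξ‖ₑ ^ 2 ≤
      ENNReal.ofReal (8 * C * (4 ^ (n - 1) * C ^ n) * layerMass φ lam u ^ 2 *
        ((bandGrad lam u).toReal / layerMass φ lam u) ^ (n + 1) / R) := by
  have hu1 : ContDiff ℝ 1 u := hu.of_le (by exact_mod_cast le_top)
  have hC0 := H.nonneg
  have hbound : ∀ y, |layer φ lam u y| ≤ 4 * lam := by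
    intro y
    rw [layer, abs_mul, abs_of_pos hlam, mul_comm]
    exact mul_le_mul_of_nonneg_right (H.abs_fst_le _) hlam.le
  refine (lintegral_ft_sq_tail (contDiff_layer H.contDiff_fst hu)
    (hasCompactSupport_layer H.fst_zero hc) hbound hR).trans ?_
  refine (mul_le_mul_right (lintegral_gradSum_comp_le hu1
    (H.contDiff_fst.differentiable (by simp)) H.abs_deriv_fst_le hlam.le hlam) _).trans ?_
  have hA := bandGrad_ne_top (lam := lam) hu1 hc
  rw [← ENNReal.ofReal_toReal hA]
  have hsob := mul_layerMass_pow_le hn H hlam hu hc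
  set A := (bandGrad lam u).toReal
  set V := layerMass φ lam u
  have hA0 : 0 ≤ A := ENNReal.toReal_nonneg
  rw [div_self hlam.ne', one_mul, ← ENNReal.ofReal_mul hC0, ← ENNReal.ofReal_mul (by positivity),
    ENNReal.toReal_ofReal hA0]
  refine ENNReal.ofReal_le_ofReal ?_
  obtain ⟨m, rfl⟩ : ∃ m, n = m + 1 := ⟨n - 1, by omega⟩
  simp only [Nat.add_sub_cancel] at hsob ⊢
  have e1 : 2 * (4 * lam) / R * (C * A) = 8 * C * A / (R * V ^ m) * (lam * V ^ m) := by
    field_simp; ring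
  have e2 : 8 * C * (4 ^ m * C ^ (m + 1)) * V ^ 2 * (A / V) ^ (m + 1 + 1) / R =
      8 * C * A / (R * V ^ m) * (4 ^ m * C ^ (m + 1) * A ^ (m + 1)) := by
    rw [div_pow]
    field_simp
    ring
  rw [e1, e2]
  exact mul_le_mul_of_nonneg_left hsob (by positivity)

theorem enorm_ft_layer_le (hu : ContDiff ℝ (⊤ : ℕ∞) u) (hc : HasCompactSupport u)
    (hφ : ContDiff ℝ (⊤ : ℕ∞) φ) (hφ0 : φ 0 = 0) (ξ : Fin n → ℝ) :
    ‖ft (layer φ lam u) ξ‖ₑ ≤ ENNReal.ofReal (layerMass φ lam u) := by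
  rw [ofReal_layerMass hφ hφ0 hu hc]
  exact enorm_ft_le _ ξ

/-- The frequency at which a layer changes behaviour. -/
def layerFreq {n : ℕ} (φ : ℝ → ℝ) (lam : ℝ) (u : (Fin n → ℝ) → ℝ) : ℝ :=
  (bandGrad lam u).toReal / layerMass φ lam u

theorem lintegral_excess_layer_le (hn : 2 ≤ n) (H : IsDyadicTruncation φ ψ C) (hlam : 0 < lam)
    (hu : ContDiff ℝ (⊤ : ℕ∞) u) (hc : HasCompactSupport u) {t : ℝ} (ht : 0 < t) :
    (∫⁻ ξ, excess (layerMass φ lam u) (layerFreq φ lam u) t ‖ξ‖ ‖ft (layer φ lam u) ξ‖ₑ) /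
        ENNReal.ofReal (t ^ n) ≤
      ENNReal.ofReal (2 ^ n + 8 * C * (4 ^ (n - 1) * C ^ n)) *
        ENNReal.ofReal (layerMass φ lam u * decay (layerFreq φ lam u) t) := by
  have hC0 := H.nonneg
  rw [← ENNReal.ofReal_mul (by positivity)]
  rcases (layerMass_nonneg (φ := φ) (lam := lam) (u := u)).eq_or_lt with hV | hV
  · have h0 : ∀ ξ, ‖ft (layer φ lam u) ξ‖ₑ = 0 := fun ξ => by
      simpa [← hV] using enorm_ft_layer_le (lam := lam) hu hc H.contDiff_fst H.fst_zero ξ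
    simp [h0, ← hV, excess_zero]
  · exact lintegral_excess_le hn hV
      (div_pos (bandGrad_toReal_pos hn H hlam hu hc hV) hV) ht (by positivity)
      fun R hR => lintegral_ft_layer_sq_tail hn H hlam hu hc hV hR

theorem lintegral_decay_layer_le (hn : 2 ≤ n) (H : IsDyadicTruncation φ ψ C) (hlam : 0 < lam)
    (hu : ContDiff ℝ (⊤ : ℕ∞) u) (hc : HasCompactSupport u) :
    ∫⁻ t in Ioi (0 : ℝ), ENNReal.ofReal (layerMass φ lam u * decay (layerFreq φ lam u) t) ≤
      9 * bandGrad lam u := by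
  rcases (layerMass_nonneg (φ := φ) (lam := lam) (u := u)).eq_or_lt with hV | hV
  · simp [← hV]
  · refine (lintegral_decay_le hV.le
      (div_pos (bandGrad_toReal_pos hn H hlam hu hc hV) hV)).trans (le_of_eq ?_)
    rw [mul_div_cancel₀ _ hV.ne', ENNReal.ofReal_mul (by norm_num),
      ENNReal.ofReal_toReal (bandGrad_ne_top (hu.of_le (by exact_mod_cast le_top)) hc)]
    simp

end Layer

/-- The restriction of `f` to a hyperplane orthogonal to the `j`-th axis. -/
def slice {n : ℕ} (f : (Fin (n + 1) → ℝ) → ℝ) (j : Fin (n + 1)) (x : ℝ) (y : Fin n → ℝ) : ℝ :=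
  f (j.insertNth x y)

theorem hasFDerivAt_insertNth {n : ℕ} (j : Fin (n + 1)) (x : ℝ) (y : Fin n → ℝ) :
    ∃ L : (Fin n → ℝ) →L[ℝ] (Fin (n + 1) → ℝ),
      HasFDerivAt (fun y : Fin n → ℝ => (j.insertNth x y : Fin (n + 1) → ℝ)) L y ∧
      ∀ i, L (Pi.single i 1) = Pi.single (j.succAbove i) 1 := by
  let L : (Fin n → ℝ) →L[ℝ] (Fin (n + 1) → ℝ) :=
    ContinuousLinearMap.pi fun k => j.insertNth (α := fun _ => (Fin n → ℝ) →L[ℝ] ℝ) 0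
      (fun i => ContinuousLinearMap.proj i) k
  refine ⟨L, ?_, fun i => ?_⟩
  · rw [hasFDerivAt_pi']
    rw [Fin.forall_iff_succAbove j]
    constructor
    · simpa [L] using hasFDerivAt_const (𝕜 := ℝ) x y
    · intro i
      simpa [L] using hasFDerivAt_apply (𝕜 := ℝ) i y
  · ext k
    revert k
    rw [Fin.forall_iff_succAbove j]
    constructor
    · simp [L]
    · intro k
      simp [L, Pi.single_apply]

theorem contDiff_insertNth {n : ℕ} {m : WithTop ℕ∞} (j : Fin (n + 1)) (x : ℝ) :
    ContDiff ℝ m fun y : Fin n → ℝ => (j.insertNth x y : Fin (n + 1) → ℝ) := by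
  rw [contDiff_pi, Fin.forall_iff_succAbove j]
  constructor
  · simpa using contDiff_const
  · intro i
    simpa using contDiff_apply ℝ ℝ i

theorem continuous_insertNth {n : ℕ} (j : Fin (n + 1)) :
    Continuous fun q : ℝ × (Fin n → ℝ) => (j.insertNth q.1 q.2 : Fin (n + 1) → ℝ) :=
  Continuous.finInsertNth (A := fun _ => ℝ) j continuous_fst continuous_snd

theorem lintegral_insertNth {n : ℕ} (j : Fin (n + 1)) {F : (Fin (n + 1) → ℝ) → ℝ≥0∞}
    (hF : Measurable F) :
    ∫⁻ x : ℝ, ∫⁻ y : Fin n → ℝ, F (j.insertNth x y) = ∫⁻ z, F z := by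
  have hmp := (volume_preserving_piFinSuccAbove (fun _ => ℝ) j).symm
  rw [← hmp.lintegral_comp hF, Measure.volume_eq_prod, lintegral_prod]
  · rfl
  · exact (hF.comp hmp.measurable).aemeasurable

section Slice

variable {n : ℕ} {f : (Fin (n + 1) → ℝ) → ℝ}

theorem contDiff_slice {m : WithTop ℕ∞} (hf : ContDiff ℝ m f) (j : Fin (n + 1)) (x : ℝ) :
    ContDiff ℝ m (slice f j x) :=
  hf.comp (contDiff_insertNth j x)

theorem hasCompactSupport_slice (hf : HasCompactSupport f) (j : Fin (n + 1)) (x : ℝ) :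
    HasCompactSupport (slice f j x) := by
  have hr : Continuous fun (z : Fin (n + 1) → ℝ) (i : Fin n) => z (j.succAbove i) := by fun_prop
  refine HasCompactSupport.intro (hf.isCompact.image hr) fun y hy => ?_
  by_contra h0
  refine hy ⟨j.insertNth x y, subset_tsupport f h0, ?_⟩
  ext i
  simp

theorem continuous_uncurry_slice (hf : Continuous f) (j : Fin (n + 1)) :
    Continuous (Function.uncurry (slice f j)) :=
  hf.comp (continuous_insertNth j)

theorem gradSum_slice (hf : Differentiable ℝ f) (j : Fin (n + 1)) (x : ℝ) (y : Fin n → ℝ) :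
    gradSum (slice f j x) y =
      ∑ i, |fderiv ℝ f (j.insertNth x y) (Pi.single (j.succAbove i) 1)| := by
  obtain ⟨L, hL, hLi⟩ := hasFDerivAt_insertNth j x y
  have h : HasFDerivAt (slice f j x) ((fderiv ℝ f (j.insertNth x y)).comp L) y :=
    (hf _).hasFDerivAt.comp y hL
  simp [gradSum, h.fderiv, hLi]

theorem gradSum_slice_le (hf : Differentiable ℝ f) (j : Fin (n + 1)) (x : ℝ) (y : Fin n → ℝ) :
    gradSum (slice f j x) y ≤ gradSum f (j.insertNth x y) := by
  rw [gradSum_slice hf, gradSum, Fin.sum_univ_succAbove _ j]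
  exact le_add_of_nonneg_left (abs_nonneg _)

theorem measurable_uncurry_gradSum_slice (hf : ContDiff ℝ 1 f) (j : Fin (n + 1)) :
    Measurable fun q : ℝ × (Fin n → ℝ) => gradSum (slice f j q.1) q.2 := by
  simp_rw [gradSum_slice (hf.differentiable one_ne_zero)]
  refine (continuous_finsetSum _ fun i _ => ?_).measurable
  exact (((hf.continuous_fderiv one_ne_zero).comp (continuous_insertNth j)).clm_apply
    continuous_const).abs

theorem measurable_uncurry_layer {φ : ℝ → ℝ} (hφ : Continuous φ) (hf : Continuous f)
    (j : Fin (n + 1)) (lam : ℝ) :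
    Measurable (Function.uncurry fun x => layer φ lam (slice f j x)) :=
  (continuous_const.mul (hφ.comp
    ((continuous_uncurry_slice hf j).div_const lam))).measurable

theorem measurable_layerMass {φ : ℝ → ℝ} (hφ : Continuous φ) (hf : Continuous f)
    (j : Fin (n + 1)) (lam : ℝ) :
    Measurable fun x => layerMass φ lam (slice f j x) :=
  (measurable_uncurry_layer hφ hf j lam).enorm.lintegral_prod_right'.ennreal_toReal

theorem measurable_uncurry_bandGrad (hf : ContDiff ℝ 1 f) (j : Fin (n + 1)) (lam : ℝ) :
    Measurable fun q : ℝ × (Fin n → ℝ) => band.indicator (1 : ℝ → ℝ≥0∞) (slice f j q.1 q.2 / lam) *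
      ENNReal.ofReal (gradSum (slice f j q.1) q.2) := by
  refine Measurable.mul ?_ (measurable_uncurry_gradSum_slice hf j).ennreal_ofReal
  exact (measurable_one.indicator measurableSet_band).comp
    ((continuous_uncurry_slice hf.continuous j).div_const lam).measurable

theorem measurable_bandGrad (hf : ContDiff ℝ 1 f) (j : Fin (n + 1)) (lam : ℝ) :
    Measurable fun x => bandGrad lam (slice f j x) :=
  (measurable_uncurry_bandGrad hf j lam).lintegral_prod_right'

theorem lintegral_tsum_bandGrad_le (hf : ContDiff ℝ 1 f) (j : Fin (n + 1)) :
    ∫⁻ x, ∑' k : ℤ, bandGrad (2 ^ k) (slice f j x) ≤ 4 * ∫⁻ z, ENNReal.ofReal (gradSum f z) := by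
  have hm := (continuous_gradSum hf).measurable.ennreal_ofReal
  rw [← lintegral_insertNth j hm, ← lintegral_const_mul' _ _ (by simp)]
  refine lintegral_mono fun x => ?_
  dsimp only
  rw [← lintegral_const_mul' _ _ (by simp)]
  unfold bandGrad
  have hu : ContDiff ℝ 1 (slice f j x) := contDiff_slice hf j x
  have hmk : ∀ k : ℤ, Measurable fun y => band.indicator (1 : ℝ → ℝ≥0∞) (slice f j x y / 2 ^ k) *
      ENNReal.ofReal (gradSum (slice f j x) y) := fun k =>
    ((measurable_one.indicator measurableSet_band).comp
      (hu.continuous.div_const _).measurable).mul (continuous_gradSum hu).measurable.ennreal_ofReal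
  rw [← lintegral_tsum fun k => (hmk k).aemeasurable]
  refine lintegral_mono fun y => ?_
  dsimp only
  rw [ENNReal.tsum_mul_right]
  exact mul_le_mul' (tsum_band_le _) (ENNReal.ofReal_le_ofReal
    (gradSum_slice_le (hf.differentiable one_ne_zero) j x y))

theorem enorm_ft_insertNth_le (hf : Integrable f) (j : Fin (n + 1)) (s : ℝ) (ξ : Fin n → ℝ) :
    ‖ft f (j.insertNth s ξ)‖ₑ ≤ ∫⁻ x, ‖ft (slice f j x) ξ‖ₑ := by
  have hmp := (volume_preserving_piFinSuccAbove (fun _ => ℝ) j).symm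
  have hint := (hmp.integrable_comp_emb
    (MeasurableEquiv.piFinSuccAbove (fun _ => ℝ) j).symm.measurableEmbedding).2
    (integrable_ft_integrand hf (j.insertNth s ξ))
  have h1 : ft f (j.insertNth s ξ) = ∫ x : ℝ,
      Complex.exp ((-2 * Real.pi * (x * s) : ℝ) * Complex.I) * ft (slice f j x) ξ := by
    rw [ft, ← hmp.integral_comp']
    rw [Measure.volume_eq_prod] at hint ⊢
    refine (integral_prod _ hint).trans (integral_congr_ae (ae_of_all _ fun x => ?_))
    dsimp only
    rw [ft, ← integral_const_mul]
    refine integral_congr_ae (ae_of_all _ fun y => ?_)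
    have hsum : (∑ i, (j.insertNth x y : Fin (n + 1) → ℝ) i *
        (j.insertNth s ξ : Fin (n + 1) → ℝ) i) = x * s + ∑ i, y i * ξ i := by
      rw [Fin.sum_univ_succAbove _ j]
      simp
    have hz : (MeasurableEquiv.piFinSuccAbove (fun _ => ℝ) j).symm (x, y) = j.insertNth x y := rfl
    dsimp only
    rw [Function.comp_apply, hz, hsum, slice, mul_left_comm, ← Complex.exp_add]
    congr 2
    push_cast
    ring
  rw [h1]
  refine (enorm_integral_le_lintegral_enorm _).trans (lintegral_mono fun x => ?_)
  rw [enorm_mul, ← ofReal_norm (Complex.exp _), Complex.norm_exp_ofReal_mul_I]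
  simp

end Slice

theorem IsDyadicTruncation.enorm_layer_le {n : ℕ} {φ ψ : ℝ → ℝ} {C : ℝ}
    (H : IsDyadicTruncation φ ψ C) (k : ℤ) (u : (Fin n → ℝ) → ℝ) (y : Fin n → ℝ) :
    ‖layer φ (2 ^ k) u y‖ₑ ≤ 8 * ‖u y‖ₑ * band.indicator 1 (u y / 2 ^ k) := by
  have hk : (0 : ℝ) < 2 ^ k := by positivity
  by_cases hb : u y / 2 ^ k ∈ band
  · rw [indicator_of_mem hb, Pi.one_apply, mul_one, ← ofReal_norm, ← ofReal_norm,
      show (8 : ℝ≥0∞) = ENNReal.ofReal 8 by simp, ← ENNReal.ofReal_mul (by norm_num)]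
    refine ENNReal.ofReal_le_ofReal ?_
    have h1 := hb.1
    rw [abs_div, abs_of_pos hk, le_div_iff₀ hk] at h1
    rw [layer, norm_mul, Real.norm_of_nonneg hk.le, Real.norm_eq_abs, Real.norm_eq_abs]
    nlinarith [H.abs_fst_le (u y / 2 ^ k)]
  · simp [layer, H.fst_eq_zero _ hb]

theorem IsDyadicTruncation.enorm_ft_le_tsum {n : ℕ} {φ ψ : ℝ → ℝ} {C : ℝ}
    (H : IsDyadicTruncation φ ψ C) {u : (Fin n → ℝ) → ℝ} (hu : Continuous u)
    (hc : HasCompactSupport u) (ξ : Fin n → ℝ) :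
    ‖ft u ξ‖ₑ ≤ ∑' k : ℤ, ‖ft (layer φ (2 ^ k) u) ξ‖ₑ := by
  have hlc : ∀ k : ℤ, Continuous (layer φ (2 ^ k) u) := fun k =>
    continuous_const.mul (H.contDiff_fst.continuous.comp (hu.div_const _))
  have hexp : Continuous fun x : Fin n → ℝ =>
      Complex.exp (-2 * Real.pi * Complex.I * (∑ i, x i * ξ i)) := by fun_prop
  have hpt : ∀ y, ∑' k : ℤ, (layer φ (2 ^ k) u y : ℂ) *
      Complex.exp (-2 * Real.pi * Complex.I * (∑ i, y i * ξ i)) =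
      (u y : ℂ) * Complex.exp (-2 * Real.pi * Complex.I * (∑ i, y i * ξ i)) := by
    intro y
    rw [tsum_mul_right]
    congr 1
    exact (Complex.hasSum_ofReal.2 (H.hasSum (u y))).tsum_eq
  have hsum : ft u ξ = ∑' k : ℤ, ft (layer φ (2 ^ k) u) ξ := by
    unfold ft
    rw [← integral_tsum]
    · exact integral_congr_ae (ae_of_all _ fun y => (hpt y).symm)
    · exact fun k => ((Complex.continuous_ofReal.comp (hlc k)).mul hexp).aestronglyMeasurable
    · have hle : ∑' k : ℤ, ∫⁻ y, ‖layer φ (2 ^ k) u y‖ₑ ≤ ∫⁻ y, 32 * ‖u y‖ₑ := by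
        rw [← lintegral_tsum fun k => (hlc k).measurable.enorm.aemeasurable]
        refine lintegral_mono fun y => ?_
        refine (ENNReal.tsum_le_tsum fun k => H.enorm_layer_le k u y).trans ?_
        rw [ENNReal.tsum_mul_left]
        refine (mul_le_mul_right (tsum_band_le _) _).trans (le_of_eq ?_)
        rw [mul_right_comm]
        norm_num
      refine ne_top_of_le_ne_top ?_ (le_trans (le_of_eq ?_) hle)
      · rw [lintegral_const_mul' _ _ (by simp)]
        exact ENNReal.mul_ne_top (by simp) (lintegral_enorm_ne_top hu hc)
      · refine tsum_congr fun k => lintegral_congr fun y => ?_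
        rw [enorm_mul, ← ofReal_norm (Complex.exp _), norm_exp_ft]
        simp [← ofReal_norm]
  rw [hsum]
  exact enorm_tsum_le_tsum_enorm

theorem measurable_decay {P : Type*} [MeasurableSpace P] {T t : P → ℝ} (hT : Measurable T)
    (ht : Measurable t) : Measurable fun p => decay (T p) (t p) :=
  measurable_const.min ((hT.div ht).pow_const _)

theorem measurable_excess {P : Type*} [MeasurableSpace P] {V T r : P → ℝ} {g : P → ℝ≥0∞}
    (hV : Measurable V) (hT : Measurable T) (hr : Measurable r) (hg : Measurable g) (t : ℝ) :
    Measurable fun p => excess (V p) (T p) t (r p) (g p) := by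
  refine Measurable.ite (measurableSet_le measurable_const hT) measurable_const ?_
  refine Measurable.ite (measurableSet_le hr
    (hT.mul ((measurable_const.div hT).pow_const _))) hV.ennreal_ofReal ?_
  exact (hg.pow_const 2).div (hV.mul (measurable_decay hT measurable_const)).ennreal_ofReal

theorem lintegral_rearr2_bigF_le {n : ℕ} (hn : 2 ≤ n) {φ ψ : ℝ → ℝ} {C : ℝ}
    (H : IsDyadicTruncation φ ψ C) {f : (Fin (n + 1) → ℝ) → ℝ} (hf : ContDiff ℝ (⊤ : ℕ∞) f)
    (hc : HasCompactSupport f) (j : Fin (n + 1)) :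
    ∫⁻ t in Ioi (0 : ℝ), rearr2 volume (bigF f t j) (t ^ n) ≤
      ENNReal.ofReal (36 * (1 + (2 ^ n + 8 * C * (4 ^ (n - 1) * C ^ n)))) *
        ∫⁻ z, ENNReal.ofReal (gradSum f z) := by
  have hC0 := H.nonneg
  set K : ℝ := 2 ^ n + 8 * C * (4 ^ (n - 1) * C ^ n) with hK
  have hK0 : 0 ≤ K := by positivity
  have hf1 : ContDiff ℝ 1 f := hf.of_le (by exact_mod_cast le_top)
  have hφc := H.contDiff_fst.continuous
  have hlam : ∀ k : ℤ, (0 : ℝ) < 2 ^ k := fun k => by positivity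
  have hu := contDiff_slice hf j
  have huc := hasCompactSupport_slice hc j
  let V : ℤ → ℝ → ℝ := fun k x => layerMass φ (2 ^ k) (slice f j x)
  let T : ℤ → ℝ → ℝ := fun k x => layerFreq φ (2 ^ k) (slice f j x)
  let G : ℤ → ℝ → (Fin n → ℝ) → ℝ≥0∞ := fun k x ξ => ‖ft (layer φ (2 ^ k) (slice f j x)) ξ‖ₑ
  have hVm : ∀ k, Measurable (V k) := fun k => measurable_layerMass hφc hf.continuous j _
  have hTm : ∀ k, Measurable (T k) := fun k =>
    (measurable_bandGrad hf1 j _).ennreal_toReal.div (hVm k)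
  have hGm : ∀ k, Measurable (Function.uncurry (G k)) := fun k =>
    (measurable_ft_param (measurable_uncurry_layer hφc hf.continuous j _)).enorm
  have hEm : ∀ k t, Measurable fun q : ℝ × (Fin n → ℝ) =>
      excess (V k q.1) (T k q.1) t ‖q.2‖ (G k q.1 q.2) := fun k t =>
    measurable_excess ((hVm k).comp measurable_fst) ((hTm k).comp measurable_fst)
      measurable_snd.norm (hGm k) t
  have hEsum : ∀ t, Measurable fun q : ℝ × (Fin n → ℝ) =>
      ∑' k, excess (V k q.1) (T k q.1) t ‖q.2‖ (G k q.1 q.2) := fun t =>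
    Measurable.tsum fun k => hEm k t
  have hDm : ∀ k, Measurable fun q : ℝ × ℝ => ENNReal.ofReal (V k q.1 * decay (T k q.1) q.2) :=
    fun k => (((hVm k).comp measurable_fst).mul
      (measurable_decay ((hTm k).comp measurable_fst) measurable_snd)).ennreal_ofReal
  have hDm1 : ∀ k t, Measurable fun x : ℝ => ENNReal.ofReal (V k x * decay (T k x) t) :=
    fun k t => ((hVm k).mul (measurable_decay (hTm k) measurable_const)).ennreal_ofReal
  have hDm2 : ∀ k x, Measurable fun t : ℝ => ENNReal.ofReal (V k x * decay (T k x) t) :=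
    fun k x => (measurable_const.mul (measurable_decay measurable_const measurable_id)).ennreal_ofReal
  have hDsum : Measurable fun q : ℝ × ℝ =>
      ∑' k, ENNReal.ofReal (V k q.1 * decay (T k q.1) q.2) := Measurable.tsum hDm
  have hpoint : ∀ t : ℝ, 0 < t → ∀ ξ, bigF f t j ξ ≤
      (∫⁻ x, ∑' k, ENNReal.ofReal (V k x * decay (T k x) t)) +
        ∫⁻ x, ∑' k, excess (V k x) (T k x) t ‖ξ‖ (G k x ξ) := by
    intro t ht ξ
    refine iSup₂_le fun s _ => ?_
    rw [← lintegral_add_left (Measurable.tsum fun k => hDm1 k t)]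
    refine (enorm_ft_insertNth_le (hf.continuous.integrable_of_hasCompactSupport hc) j s ξ).trans
      (lintegral_mono fun x => ?_)
    refine (H.enorm_ft_le_tsum (hu x).continuous (huc x) ξ).trans ?_
    rw [← ENNReal.tsum_add]
    exact ENNReal.tsum_le_tsum fun k => le_add_excess ht
      (enorm_ft_layer_le (hu x) (huc x) H.contDiff_fst H.fst_zero ξ)
  have hrearr : ∀ t : ℝ, 0 < t → rearr2 volume (bigF f t j) (t ^ n) ≤
      ENNReal.ofReal (1 + K) * ∫⁻ x, ∑' k, ENNReal.ofReal (V k x * decay (T k x) t) := by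
    intro t ht
    have hswap : (∫⁻ ξ, ∫⁻ x, ∑' k, excess (V k x) (T k x) t ‖ξ‖ (G k x ξ)) /
        ENNReal.ofReal (t ^ n) ≤
        ENNReal.ofReal K * ∫⁻ x, ∑' k, ENNReal.ofReal (V k x * decay (T k x) t) := by
      have htn : (ENNReal.ofReal (t ^ n))⁻¹ ≠ ⊤ := by
        have : 0 < t ^ n := by positivity
        simpa using this
      rw [← lintegral_lintegral_swap (hEsum t).aemeasurable, div_eq_mul_inv,
        ← lintegral_mul_const' _ _ htn, ← lintegral_const_mul' _ _ ofReal_ne_top]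
      refine lintegral_mono fun x => ?_
      dsimp only
      have hEx : ∀ k, Measurable fun ξ => excess (V k x) (T k x) t ‖ξ‖ (G k x ξ) := fun k =>
        measurable_excess measurable_const measurable_const measurable_norm
          (measurable_ft (contDiff_layer H.contDiff_fst (hu x)).continuous.measurable).enorm t
      rw [lintegral_tsum fun k => (hEx k).aemeasurable,
        ← ENNReal.tsum_mul_right, ← ENNReal.tsum_mul_left]
      refine ENNReal.tsum_le_tsum fun k => ?_
      rw [← div_eq_mul_inv]
      exact lintegral_excess_layer_le hn H (hlam k) (hu x) (huc x) ht
    refine (rearr2_le_const_add_lintegral volume (hEsum t).lintegral_prod_left'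
      (hpoint t ht) (by positivity)).trans ?_
    rw [ENNReal.ofReal_add zero_le_one hK0, ENNReal.ofReal_one, add_mul, one_mul]
    exact add_le_add_right hswap _
  calc ∫⁻ t in Ioi (0 : ℝ), rearr2 volume (bigF f t j) (t ^ n)
      ≤ ∫⁻ t in Ioi (0 : ℝ),
          ENNReal.ofReal (1 + K) * ∫⁻ x, ∑' k, ENNReal.ofReal (V k x * decay (T k x) t) :=
        setLIntegral_mono' measurableSet_Ioi fun t ht => hrearr t ht
    _ = ENNReal.ofReal (1 + K) *
          ∫⁻ x, ∫⁻ t in Ioi (0 : ℝ), ∑' k, ENNReal.ofReal (V k x * decay (T k x) t) := by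
        rw [lintegral_const_mul' _ _ ofReal_ne_top, ← lintegral_lintegral_swap hDsum.aemeasurable]
    _ ≤ ENNReal.ofReal (1 + K) * ∫⁻ x, 9 * ∑' k : ℤ, bandGrad (2 ^ k) (slice f j x) := by
        refine mul_le_mul_right (lintegral_mono fun x => ?_) _
        dsimp only
        rw [lintegral_tsum fun k => (hDm2 k x).aemeasurable, ← ENNReal.tsum_mul_left]
        exact ENNReal.tsum_le_tsum fun k =>
          lintegral_decay_layer_le hn H (hlam k) (hu x) (huc x)
    _ ≤ ENNReal.ofReal (1 + K) * (9 * (4 * ∫⁻ z, ENNReal.ofReal (gradSum f z))) := by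
        rw [lintegral_const_mul' _ _ (by simp)]
        gcongr
        exact lintegral_tsum_bandGrad_le hf1 j
    _ = _ := by
        rw [ENNReal.ofReal_mul (by norm_num), show ENNReal.ofReal 36 = 9 * 4 by norm_num]
        ring

/-- The convolution of `g` with `ρ`. -/
def mollify {m : ℕ} (ρ g : (Fin m → ℝ) → ℝ) (x : Fin m → ℝ) : ℝ := ∫ t, g t * ρ (x - t)

section Mollify

variable {m : ℕ} {ρ g : (Fin m → ℝ) → ℝ}

theorem mollify_eq_convolution (ρ g : (Fin m → ℝ) → ℝ) :
    mollify ρ g = convolution g ρ (ContinuousLinearMap.mul ℝ ℝ) volume := rfl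

theorem lintegral_mollify_le (hρ : Continuous ρ) (hc : HasCompactSupport ρ) (h0 : ∀ x, 0 ≤ ρ x)
    (h1 : ∫ x, ρ x = 1) (hg : AEStronglyMeasurable g) :
    ∫⁻ x, ‖mollify ρ g x‖ₑ ≤ ∫⁻ x, ‖g x‖ₑ := by
  have hmass : ∫⁻ x, ‖ρ x‖ₑ = 1 := by
    rw [← ofReal_integral_norm_eq_lintegral_enorm (hρ.integrable_of_hasCompactSupport hc)]
    simp_rw [Real.norm_of_nonneg (h0 _)]
    rw [h1, ENNReal.ofReal_one]
  have hm : AEMeasurable (Function.uncurry fun x t : Fin m → ℝ => ‖g t‖ₑ * ‖ρ (x - t)‖ₑ)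
      (volume.prod volume) := by
    refine AEMeasurable.mul hg.comp_snd.enorm ?_
    exact (hρ.comp (continuous_fst.sub continuous_snd)).measurable.enorm.aemeasurable
  calc ∫⁻ x, ‖mollify ρ g x‖ₑ ≤ ∫⁻ x, ∫⁻ t, ‖g t‖ₑ * ‖ρ (x - t)‖ₑ := by
        refine lintegral_mono fun x => (enorm_integral_le_lintegral_enorm _).trans (le_of_eq ?_)
        simp_rw [enorm_mul]
    _ = ∫⁻ t, ∫⁻ x, ‖g t‖ₑ * ‖ρ (x - t)‖ₑ := lintegral_lintegral_swap hm
    _ = ∫⁻ t, ‖g t‖ₑ := by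
        refine lintegral_congr fun t => ?_
        rw [lintegral_const_mul' _ _ enorm_ne_top,
          lintegral_sub_right_eq_self (fun x => ‖ρ x‖ₑ) t, hmass, mul_one]

theorem contDiff_mollify (hρ : ContDiff ℝ (⊤ : ℕ∞) ρ) (hc : HasCompactSupport ρ)
    (hg : Integrable g) : ContDiff ℝ (⊤ : ℕ∞) (mollify ρ g) :=
  hc.contDiff_convolution_right (ContinuousLinearMap.mul ℝ ℝ) hg.locallyIntegrable hρ

theorem IsWeakDeriv.fderiv_mollify {D : (Fin m → ℝ) → ℝ} {j : Fin m} (h : IsWeakDeriv j g D)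
    (hρ : ContDiff ℝ (⊤ : ℕ∞) ρ) (hc : HasCompactSupport ρ) (hg : Integrable g)
    (x : Fin m → ℝ) : fderiv ℝ (mollify ρ g) x (Pi.single j 1) = mollify ρ D x := by
  have hρ1 : ContDiff ℝ 1 ρ := hρ.of_le (by exact_mod_cast le_top)
  have hd := hc.hasFDerivAt_convolution_right (ContinuousLinearMap.mul ℝ ℝ)
    hg.locallyIntegrable hρ1 x
  rw [mollify_eq_convolution, hd.fderiv, convolution_precompR_apply _ hg.locallyIntegrable
    (hc.fderiv ℝ) (hρ1.continuous_fderiv one_ne_zero)]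
  have hφ : ContDiff ℝ (⊤ : ℕ∞) fun t => ρ (x - t) := hρ.comp (contDiff_const.sub contDiff_id)
  have hφc : HasCompactSupport fun t => ρ (x - t) :=
    hc.comp_homeomorph (Homeomorph.subLeft x)
  have hw := h _ hφ hφc
  have hderiv : ∀ t : Fin m → ℝ, deriv (fun s => ρ (x - Function.update t j s)) (t j) =
      -fderiv ℝ ρ (x - t) (Pi.single j 1) := by
    intro t
    have h1 : HasDerivAt (fun s => x - Function.update t j s) (-Pi.single j 1) (t j) :=
      (hasDerivAt_update t j (t j)).const_sub x
    have h2 : HasFDerivAt ρ (fderiv ℝ ρ (x - t)) (x - Function.update t j (t j)) := by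
      rw [Function.update_eq_self]
      exact (hρ1.differentiable one_ne_zero _).hasFDerivAt
    have := (h2.comp_hasDerivAt (t j) h1).deriv
    rwa [map_neg] at this
  simp_rw [hderiv, mul_neg, integral_neg, neg_inj] at hw
  exact hw

theorem mollify_sub {h : (Fin m → ℝ) → ℝ} (hρ : Continuous ρ) (hc : HasCompactSupport ρ)
    (hg : Integrable g) (hh : Integrable h) (x : Fin m → ℝ) :
    mollify ρ (fun t => g t - h t) x = mollify ρ g x - mollify ρ h x := by
  obtain ⟨B, hB⟩ := hc.exists_bound_of_continuous hρ
  have hint : ∀ {k : (Fin m → ℝ) → ℝ}, Integrable k → Integrable fun t => k t * ρ (x - t) :=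
    fun hk => hk.mul_bdd (c := B)
      (hρ.comp (continuous_const.sub continuous_id)).aestronglyMeasurable
      (ae_of_all _ fun t => hB _)
  unfold mollify
  rw [← integral_sub (hint hg) (hint hh)]
  simp_rw [sub_mul]

end Mollify

theorem lintegral_enorm_sub_le {m : ℕ} {f g h : (Fin m → ℝ) → ℝ} (hf : AEStronglyMeasurable f)
    (hg : AEStronglyMeasurable g) :
    ∫⁻ x, ‖f x - h x‖ₑ ≤ (∫⁻ x, ‖f x - g x‖ₑ) + ∫⁻ x, ‖g x - h x‖ₑ := by
  have hm : AEMeasurable fun x => ‖f x - g x‖ₑ := (hf.sub hg).enorm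
  rw [← lintegral_add_left' hm]
  refine lintegral_mono fun x => ?_
  rw [← sub_add_sub_cancel (f x) (g x) (h x)]
  exact enorm_add_le _ _

theorem exists_mollifier_hasCompactSupport {m : ℕ} {h : (Fin m → ℝ) → ℝ} (hh : Continuous h)
    (hc : HasCompactSupport h) {ε : ℝ≥0∞} (hε : ε ≠ 0) :
    ∃ b : ContDiffBump (0 : Fin m → ℝ), ∫⁻ x, ‖h x - mollify (b.normed volume) h x‖ₑ ≤ ε := by
  set K : Set (Fin m → ℝ) := Metric.cthickening 1 (tsupport h) with hK
  have hKc : IsCompact K := hc.isCompact.cthickening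
  have hKfin : volume K ≠ ⊤ := hKc.measure_lt_top.ne
  obtain ⟨η, hη, hηε⟩ : ∃ η : ℝ, 0 < η ∧ ENNReal.ofReal η * volume K ≤ ε := by
    rcases eq_or_ne ε ⊤ with rfl | hε'
    · exact ⟨1, one_pos, le_top⟩
    · refine ⟨ε.toReal / ((volume K).toReal + 1),
        div_pos (ENNReal.toReal_pos hε hε') (by positivity), ?_⟩
      rw [← ENNReal.ofReal_toReal hKfin, ← ENNReal.ofReal_mul (by positivity),
        ENNReal.toReal_ofReal (by positivity)]
      refine (ENNReal.ofReal_le_ofReal ?_).trans (ENNReal.ofReal_toReal hε').le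
      rw [div_mul_eq_mul_div, div_le_iff₀ (by positivity)]
      exact mul_le_mul_of_nonneg_left (by linarith) (by positivity)
  obtain ⟨δ, hδ, hδη⟩ := Metric.uniformContinuous_iff.1 (hc.uniformContinuous_of_continuous hh) η hη
  let r : ℝ := min δ 1
  have hr : 0 < r := lt_min hδ one_pos
  let b : ContDiffBump (0 : Fin m → ℝ) := ⟨r / 2, r, by positivity, by linarith⟩
  have hconv : ∀ x, mollify (b.normed volume) h x =
      convolution (b.normed volume) h (ContinuousLinearMap.lsmul ℝ ℝ) volume x := by
    intro x
    rw [convolution_eq_swap, mollify]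
    simp [mul_comm]
  refine ⟨b, le_trans (lintegral_mono (g := K.indicator fun _ => ENNReal.ofReal η) fun x => ?_) ?_⟩
  · have hdist : ∀ e : ℝ, (∀ y ∈ Metric.ball x b.rOut, dist (h y) (h x) ≤ e) →
        ‖h x - mollify (b.normed volume) h x‖ₑ ≤ ENNReal.ofReal e := by
      intro e he
      rw [hconv, ← ofReal_norm, ← dist_eq_norm, dist_comm]
      exact ENNReal.ofReal_le_ofReal
        (b.dist_normed_convolution_le hh.aestronglyMeasurable he)
    by_cases hx : x ∈ K
    · rw [indicator_of_mem hx]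
      exact hdist η fun y hy =>
        (hδη (lt_of_lt_of_le (Metric.mem_ball.1 hy) (min_le_left _ _))).le
    · rw [indicator_of_notMem hx]
      refine (hdist 0 fun y hy => ?_).trans (by simp)
      have hz : ∀ y, dist y x ≤ 1 → h y = 0 := by
        intro y hy
        by_contra hne
        exact hx (Metric.mem_cthickening_of_dist_le x y 1 _ (subset_tsupport h hne)
          (by rwa [dist_comm]))
      rw [hz y ((Metric.mem_ball.1 hy).le.trans (min_le_right _ _)), hz x (by simp), dist_self]
  · rw [lintegral_indicator hKc.measurableSet, setLIntegral_const]
    exact hηε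

theorem exists_mollifier {m : ℕ} {f : (Fin m → ℝ) → ℝ} (hf : Integrable f) {ε : ℝ≥0∞}
    (hε : ε ≠ 0) :
    ∃ b : ContDiffBump (0 : Fin m → ℝ), ∫⁻ x, ‖f x - mollify (b.normed volume) f x‖ₑ ≤ ε := by
  have hε3 : ε / 3 ≠ 0 := by simp [hε]
  obtain ⟨h, hhc, hfh, hh, hhi⟩ := hf.exists_hasCompactSupport_lintegral_sub_le hε3
  obtain ⟨b, hb⟩ := exists_mollifier_hasCompactSupport hh hhc hε3
  refine ⟨b, ?_⟩
  have hbc : Continuous (b.normed volume) := b.continuous_normed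
  have hbs : HasCompactSupport (b.normed volume) := b.hasCompactSupport_normed
  have hmc : Continuous (mollify (b.normed volume) h) :=
    (contDiff_mollify b.contDiff_normed hbs hhi).continuous
  have hlast : ∫⁻ x, ‖mollify (b.normed volume) h x - mollify (b.normed volume) f x‖ₑ ≤ ε / 3 := by
    simp_rw [← mollify_sub hbc hbs hhi hf]
    refine (lintegral_mollify_le hbc hbs b.nonneg_normed b.integral_normed
      (hhi.sub hf).aestronglyMeasurable).trans (le_trans (le_of_eq ?_) hfh)
    exact lintegral_congr fun x => enorm_sub_rev _ _
  calc ∫⁻ x, ‖f x - mollify (b.normed volume) f x‖ₑ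
      ≤ (∫⁻ x, ‖f x - h x‖ₑ) + ∫⁻ x, ‖h x - mollify (b.normed volume) f x‖ₑ :=
        lintegral_enorm_sub_le hf.aestronglyMeasurable hh.aestronglyMeasurable
    _ ≤ ε / 3 + (ε / 3 + ε / 3) := add_le_add hfh
        ((lintegral_enorm_sub_le hh.aestronglyMeasurable hmc.aestronglyMeasurable).trans
          (add_le_add hb hlast))
    _ = ε := by rw [← add_assoc, ENNReal.add_thirds]

section Cutoff

variable {m : ℕ} {w : (Fin m → ℝ) → ℝ}

theorem gradSum_mul_le {χ : (Fin m → ℝ) → ℝ} (hχ : Differentiable ℝ χ) (hw : Differentiable ℝ w)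
    (x : Fin m → ℝ) :
    gradSum (fun y => χ y * w y) x ≤ |χ x| * gradSum w x + |w x| * gradSum χ x := by
  rw [gradSum, gradSum, gradSum, Finset.mul_sum, Finset.mul_sum, ← Finset.sum_add_distrib]
  refine Finset.sum_le_sum fun i _ => ?_
  have h := ((hχ x).hasFDerivAt.mul (hw x).hasFDerivAt).fderiv
  rw [show fderiv ℝ (fun y => χ y * w y) x = _ from h]
  simp only [add_apply, smul_apply, smul_eq_mul]
  exact (abs_add_le _ _).trans (by rw [abs_mul, abs_mul])

theorem gradSum_comp_smul {χ : (Fin m → ℝ) → ℝ} (hχ : Differentiable ℝ χ) (a : ℝ)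
    (x : Fin m → ℝ) : gradSum (fun y => χ (a • y)) x = |a| * gradSum χ (a • x) := by
  have h1 : HasFDerivAt (fun y : Fin m → ℝ => a • y)
      (a • ContinuousLinearMap.id ℝ (Fin m → ℝ)) x := (hasFDerivAt_id x).const_smul a
  have h2 := ((hχ (a • x)).hasFDerivAt.comp x h1).fderiv
  rw [gradSum, gradSum, Finset.mul_sum]
  refine Finset.sum_congr rfl fun i _ => ?_
  rw [show fderiv ℝ (fun y => χ (a • y)) x = _ from h2]
  simp [abs_mul]

/-- A smooth integrable function is approximated in `L¹` by smooth compactly supported functions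
without increasing the `L¹` norm of the gradient by more than a prescribed amount. -/
theorem exists_hasCompactSupport_gradSum_le (hw : ContDiff ℝ (⊤ : ℕ∞) w) (hwi : Integrable w)
    {ε : ℝ≥0∞} (hε : ε ≠ 0) :
    ∃ v : (Fin m → ℝ) → ℝ, ContDiff ℝ (⊤ : ℕ∞) v ∧ HasCompactSupport v ∧
      ∫⁻ x, ‖w x - v x‖ₑ ≤ ε ∧
      ∫⁻ x, ENNReal.ofReal (gradSum v x) ≤ (∫⁻ x, ENNReal.ofReal (gradSum w x)) + ε := by
  let χ : ContDiffBump (0 : Fin m → ℝ) := ⟨1, 2, one_pos, one_lt_two⟩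
  have hχ : ContDiff ℝ (⊤ : ℕ∞) χ := χ.contDiff
  have hχ1 : ContDiff ℝ 1 χ := χ.contDiff
  have hχd : Differentiable ℝ χ := hχ1.differentiable one_ne_zero
  have hw1 : ContDiff ℝ 1 w := hw.of_le (by exact_mod_cast le_top)
  obtain ⟨B, hB⟩ := (hasCompactSupport_gradSum χ.hasCompactSupport).exists_bound_of_continuous
    (continuous_gradSum hχ1)
  let a : ℕ → ℝ := fun k => 1 / ((k : ℝ) + 1)
  have ha : ∀ k, 0 < a k := fun k => by positivity
  have ha0 : Filter.Tendsto a Filter.atTop (nhds 0) := tendsto_one_div_add_atTop_nhds_zero_nat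
  let v : ℕ → (Fin m → ℝ) → ℝ := fun k x => χ (a k • x) * w x
  have hscale : ∀ k, ContDiff ℝ (⊤ : ℕ∞) fun x => χ (a k • x) := fun k =>
    hχ.comp (contDiff_const_smul (a k))
  have hv : ∀ k, ContDiff ℝ (⊤ : ℕ∞) (v k) := fun k => (hscale k).mul hw
  have hvc : ∀ k, HasCompactSupport (v k) := fun k =>
    (χ.hasCompactSupport.comp_smul (ha k).ne').mul_right
  have hle : ∀ x, |χ x| ≤ 1 := fun x => by
    rw [abs_of_nonneg χ.nonneg]
    exact χ.le_one
  have hgrad : ∀ k x, ENNReal.ofReal (gradSum (v k) x) ≤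
      ENNReal.ofReal (gradSum w x) + ENNReal.ofReal (a k * B) * ‖w x‖ₑ := by
    intro k x
    rw [← ofReal_norm, ← ENNReal.ofReal_mul' (norm_nonneg _)]
    refine (ENNReal.ofReal_le_ofReal ?_).trans ENNReal.ofReal_add_le
    refine (gradSum_mul_le ((hscale k).differentiable (by simp))
      (hw1.differentiable one_ne_zero) x).trans (add_le_add ?_ ?_)
    · exact mul_le_of_le_one_left (gradSum_nonneg _ _) (hle _)
    · rw [gradSum_comp_smul hχd, abs_of_pos (ha k), mul_comm, Real.norm_eq_abs]
      exact mul_le_mul_of_nonneg_right (mul_le_mul_of_nonneg_left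
        ((le_abs_self _).trans (hB _)) (ha k).le) (abs_nonneg _)
  have hlim1 : Filter.Tendsto (fun k => ∫⁻ x, ‖w x - v k x‖ₑ) Filter.atTop (nhds 0) := by
    have h := tendsto_lintegral_of_dominated_convergence (μ := volume)
      (F := fun k x => ‖w x - v k x‖ₑ) (f := fun _ => 0) (fun x => ‖w x‖ₑ)
      (fun k => (hw.continuous.sub (hv k).continuous).measurable.enorm)
      (fun k => ae_of_all _ fun x => ?_) hwi.2.ne (ae_of_all _ fun x => ?_)
    · simpa using h
    · have hfac : w x - v k x = (1 - χ (a k • x)) * w x := by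
        simp only [v]
        ring
      have h0 : 0 ≤ χ (a k • x) := χ.nonneg
      have h1 : χ (a k • x) ≤ 1 := χ.le_one
      beta_reduce
      rw [hfac, ← ofReal_norm, ← ofReal_norm, norm_mul, Real.norm_of_nonneg (by linarith)]
      exact ENNReal.ofReal_le_ofReal (mul_le_of_le_one_left (norm_nonneg _) (by linarith))
    · refine tendsto_const_nhds.congr' ?_
      have hx : Filter.Tendsto (fun k => a k • x) Filter.atTop (nhds 0) := by
        simpa using ha0.smul_const x
      filter_upwards [hx.eventually (Metric.closedBall_mem_nhds 0 one_pos)] with k hk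
      have : χ (a k • x) = 1 := χ.one_of_mem_closedBall hk
      simp [v, this]
  have hlim2 : Filter.Tendsto (fun k => ENNReal.ofReal (a k * B) * ∫⁻ x, ‖w x‖ₑ)
      Filter.atTop (nhds 0) := by
    have h := ENNReal.Tendsto.mul_const (ENNReal.tendsto_ofReal (ha0.mul_const B))
      (Or.inr hwi.2.ne)
    simpa using h
  have hpos : 0 < ε := pos_iff_ne_zero.2 hε
  obtain ⟨k, hk1, hk2⟩ := ((hlim1.eventually (gt_mem_nhds hpos)).and
    (hlim2.eventually (gt_mem_nhds hpos))).exists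
  refine ⟨v k, hv k, hvc k, hk1.le, (lintegral_mono (hgrad k)).trans ?_⟩
  rw [lintegral_add_left (continuous_gradSum hw1).measurable.ennreal_ofReal,
    lintegral_const_mul _ hw.continuous.measurable.enorm]
  exact add_le_add_right hk2.le _

end Cutoff

/-- Functions with integrable weak derivatives are approximated in `L¹` by test functions whose
gradients have almost no larger `L¹` norm. -/
theorem exists_testFunction_approx {m : ℕ} {f : (Fin m → ℝ) → ℝ}
    {D : Fin m → (Fin m → ℝ) → ℝ} (hf : Integrable f) (hD : ∀ j, Integrable (D j))
    (hw : ∀ j, IsWeakDeriv j f (D j)) {ε : ℝ≥0∞} (hε : ε ≠ 0) :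
    ∃ v : (Fin m → ℝ) → ℝ, ContDiff ℝ (⊤ : ℕ∞) v ∧ HasCompactSupport v ∧
      ∫⁻ x, ‖f x - v x‖ₑ ≤ ε ∧
      ∫⁻ x, ENNReal.ofReal (gradSum v x) ≤ (∑ j, eLpNorm (D j) 1 volume) + ε := by
  have hε2 : ε / 2 ≠ 0 := by simp [hε]
  obtain ⟨b, hb⟩ := exists_mollifier hf hε2
  have hbs : HasCompactSupport (b.normed volume) := b.hasCompactSupport_normed
  have hbd : ContDiff ℝ (⊤ : ℕ∞) (b.normed volume) := b.contDiff_normed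
  have hmd := contDiff_mollify hbd hbs hf
  have hL1 : ∀ {g : (Fin m → ℝ) → ℝ}, Integrable g →
      ∫⁻ x, ‖mollify (b.normed volume) g x‖ₑ ≤ ∫⁻ x, ‖g x‖ₑ := fun hg =>
    lintegral_mollify_le hbd.continuous hbs b.nonneg_normed b.integral_normed
      hg.aestronglyMeasurable
  have hmi : Integrable (mollify (b.normed volume) f) :=
    ⟨hmd.continuous.aestronglyMeasurable, (hL1 hf).trans_lt hf.2⟩
  have hgrad : ∫⁻ x, ENNReal.ofReal (gradSum (mollify (b.normed volume) f) x) ≤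
      ∑ j, eLpNorm (D j) 1 volume := by
    have hpt : ∀ x, ENNReal.ofReal (gradSum (mollify (b.normed volume) f) x) =
        ∑ j, ‖mollify (b.normed volume) (D j) x‖ₑ := by
      intro x
      rw [gradSum, ENNReal.ofReal_sum_of_nonneg fun i _ => abs_nonneg _]
      refine Finset.sum_congr rfl fun j _ => ?_
      rw [(hw j).fderiv_mollify hbd hbs hf, ← Real.norm_eq_abs, ofReal_norm]
    simp_rw [hpt]
    rw [lintegral_finsetSum _ fun j _ =>
      (contDiff_mollify hbd hbs (hD j)).continuous.measurable.enorm]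
    exact Finset.sum_le_sum fun j _ => (hL1 (hD j)).trans (eLpNorm_one_eq_lintegral_enorm).ge
  obtain ⟨v, hv, hvc, hv1, hv2⟩ := exists_hasCompactSupport_gradSum_le hmd hmi hε2
  refine ⟨v, hv, hvc, ?_, hv2.trans (add_le_add hgrad ENNReal.half_le_self)⟩
  refine (lintegral_enorm_sub_le hf.aestronglyMeasurable hmi.aestronglyMeasurable).trans ?_
  exact (add_le_add hb hv1).trans (ENNReal.add_halves ε).le

theorem rearr2_bigF_le_add {n : ℕ} {f v : (Fin (n + 1) → ℝ) → ℝ} (hf : Integrable f)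
    (hv : Integrable v) (t : ℝ) (j : Fin (n + 1)) {s : ℝ} (hs : 0 < s) :
    rearr2 volume (bigF f t j) s ≤ (∫⁻ x, ‖f x - v x‖ₑ) + rearr2 volume (bigF v t j) s := by
  refine (rearr2_mono volume (fun ξ => ?_) s).trans (rearr2_const_add_le volume _ _ hs)
  refine iSup₂_le fun r hr => ?_
  have hsub := ft_sub hf hv (j.insertNth r ξ)
  calc ‖ft f (j.insertNth r ξ)‖ₑ
      = ‖ft (fun x => f x - v x) (j.insertNth r ξ) + ft v (j.insertNth r ξ)‖ₑ := by
        rw [hsub, sub_add_cancel]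
    _ ≤ (∫⁻ x, ‖f x - v x‖ₑ) + bigF v t j ξ :=
        (enorm_add_le _ _).trans (add_le_add (enorm_ft_le _ _)
          (le_iSup₂ (f := fun (s : ℝ) (_ : t ≤ |s|) =>
            (‖ft v (j.insertNth s ξ)‖₊ : ℝ≥0∞)) r hr))

theorem setLIntegral_Ioi_le_of_forall_Ioc {g : ℝ → ℝ≥0∞} {M : ℝ≥0∞}
    (h : ∀ N : ℕ, ∫⁻ t in Ioc (0 : ℝ) N, g t ≤ M) : ∫⁻ t in Ioi (0 : ℝ), g t ≤ M := by
  have hU : (⋃ N : ℕ, Ioc (0 : ℝ) N) = Ioi 0 := by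
    ext t
    simp only [mem_iUnion, mem_Ioc, mem_Ioi]
    exact ⟨fun ⟨_, ht⟩ => ht.1, fun ht => (exists_nat_ge t).imp fun _ hN => ⟨ht, hN⟩⟩
  have hmono : Monotone fun N : ℕ => Ioc (0 : ℝ) N :=
    fun _ _ hab => Ioc_subset_Ioc_right (Nat.cast_le.2 hab)
  rw [← hU, setLIntegral_iUnion_of_directed g hmono.directed_le]
  exact iSup_le h

theorem exists_lintegral_rearr2_bigF_le {n : ℕ} (hn : 2 ≤ n) : ∃ c > 0,
    ∀ (f : (Fin (n + 1) → ℝ) → ℝ) (D : Fin (n + 1) → (Fin (n + 1) → ℝ) → ℝ),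
      Integrable f → (∀ j, Integrable (D j)) → (∀ j, IsWeakDeriv j f (D j)) →
      ∀ j, ∫⁻ t in Ioi (0 : ℝ), rearr2 volume (bigF f t j) (t ^ n) ≤
        ENNReal.ofReal c * ∑ k, eLpNorm (D k) 1 volume := by
  obtain ⟨φ, ψ, C, H⟩ := exists_isDyadicTruncation
  have hC := H.nonneg
  refine ⟨36 * (1 + (2 ^ n + 8 * C * (4 ^ (n - 1) * C ^ n))), by positivity, ?_⟩
  intro f D hf hD hw j
  set c : ℝ := 36 * (1 + (2 ^ n + 8 * C * (4 ^ (n - 1) * C ^ n))) with hc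
  refine setLIntegral_Ioi_le_of_forall_Ioc fun N => ?_
  have key : ∀ ε : ℝ≥0∞, ε ≠ 0 →
      ∫⁻ t in Ioc (0 : ℝ) N, rearr2 volume (bigF f t j) (t ^ n) ≤
        ENNReal.ofReal c * (∑ k, eLpNorm (D k) 1 volume) + (N + ENNReal.ofReal c) * ε := by
    intro ε hε
    obtain ⟨v, hv, hvc, hfv, hgv⟩ := exists_testFunction_approx hf hD hw hε
    have hvi : Integrable v := hv.continuous.integrable_of_hasCompactSupport hvc
    calc ∫⁻ t in Ioc (0 : ℝ) N, rearr2 volume (bigF f t j) (t ^ n)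
        ≤ ∫⁻ t in Ioc (0 : ℝ) N, (ε + rearr2 volume (bigF v t j) (t ^ n)) :=
          setLIntegral_mono' measurableSet_Ioc fun t ht =>
            (rearr2_bigF_le_add hf hvi t j (pow_pos ht.1 n)).trans (by gcongr)
      _ = ε * N + ∫⁻ t in Ioc (0 : ℝ) N, rearr2 volume (bigF v t j) (t ^ n) := by
          rw [lintegral_add_left measurable_const, setLIntegral_const, Real.volume_Ioc, sub_zero,
            ENNReal.ofReal_natCast]
      _ ≤ ε * N + ENNReal.ofReal c * ((∑ k, eLpNorm (D k) 1 volume) + ε) := by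
          refine add_le_add_right ?_ _
          refine (lintegral_mono_set Ioc_subset_Ioi_self).trans ?_
          exact (lintegral_rearr2_bigF_le hn H hv hvc j).trans (by gcongr)
      _ = ENNReal.ofReal c * (∑ k, eLpNorm (D k) 1 volume) + (N + ENNReal.ofReal c) * ε := by
          ring
  have hlim : Filter.Tendsto (fun ε : ℝ≥0∞ => ENNReal.ofReal c * (∑ k, eLpNorm (D k) 1 volume) +
      (N + ENNReal.ofReal c) * ε) (nhdsWithin 0 (Ioi 0))
      (nhds (ENNReal.ofReal c * ∑ k, eLpNorm (D k) 1 volume)) := by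
    have h := (ENNReal.Tendsto.const_mul (a := (N : ℝ≥0∞) + ENNReal.ofReal c)
      (Filter.tendsto_id (x := nhds (0 : ℝ≥0∞))) (Or.inr (by simp))).const_add
      (ENNReal.ofReal c * ∑ k, eLpNorm (D k) 1 volume)
    rw [mul_zero, add_zero] at h
    exact h.mono_left nhdsWithin_le_nhds
  refine ge_of_tendsto hlim ?_
  filter_upwards [self_mem_nhdsWithin] with ε hε
  exact key ε (ne_of_gt hε)

/-- Theorem 6.4 (dimension n+1 ≥ 3 here): for f ∈ W¹₁(ℝⁿ),
Σ_j ∫₀^∞ F_{t,j}^{**}(t^{n-1}) dt ≤ c ‖∇f‖₁. -/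
theorem fourier_sup_maximal_bound (n : ℕ) (hn : 2 ≤ n) :
    ∃ c > 0, ∀ (f : (Fin (n+1) → ℝ) → ℝ) (D : Fin (n+1) → (Fin (n+1) → ℝ) → ℝ),
      Integrable f volume → (∀ j, Integrable (D j) volume) →
      (∀ j, IsWeakDeriv j f (D j)) →
      ∑ j : Fin (n+1),
          ∫⁻ t in Set.Ioi (0:ℝ), rearr2 volume (bigF f t j) (t ^ n)
        ≤ ENNReal.ofReal c * ∑ j : Fin (n+1), eLpNorm (D j) 1 volume := by
  obtain ⟨c, hc, h⟩ := exists_lintegral_rearr2_bigF_le hn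
  refine ⟨(n + 1 : ℕ) * c, by positivity, fun f D hf hD hw => ?_⟩
  refine (Finset.sum_le_sum fun j _ => h f D hf hD hw j).trans ?_
  rw [Finset.sum_const, Finset.card_univ, Fintype.card_fin, nsmul_eq_mul,
    ENNReal.ofReal_mul (Nat.cast_nonneg _), ENNReal.ofReal_natCast, mul_assoc]
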